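/- arXiv:1406.3336 — 3 statements merged into one kernel-verified Lean document; each statement's English description precedes it below -/
import Mathlib

section
/- For 0 < α < 1 and every δ > -1, the Mainardi function M_α(r) = Σ_{n=0}^∞ (-r)^n / (n! Γ(-αn + 1 - α)) satisfies ∫₀^∞ r^δ M_α(r) dr = Γ(δ+1) / Γ(αδ + 1). -/
open Real MeasureTheory

/-- The Mainardi (Wright-type) function. -/
noncomputable def mainardi (α r : ℝ) : ℝ :=
  ∑' n : ℕ, (-r) ^ n / (n.factorial * Real.Gamma (-α * n + 1 - α))

/-- Integrability of `t ^ (x - 1) * exp (-b t)` on the half-line. -/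
lemma integrableOn_rpow_sub_one_mul_exp_neg_mul {x b : ℝ} (hx : 0 < x) (hb : 0 < b) :
    IntegrableOn (fun t : ℝ => t ^ (x - 1) * exp (-(b * t))) (Set.Ioi 0) := by
  have := integrableOn_rpow_mul_exp_neg_mul_rpow (p := 1) (s := x - 1) (b := b)
    (by linarith) one_pos hb
  simpa [neg_mul] using this

lemma norm_rpow_mul_cexp_neg_mul {x t : ℝ} (ht : 0 < t) (z : ℂ) :
    ‖((t ^ x : ℝ) : ℂ) * Complex.exp (-(z * t))‖ = t ^ x * exp (-(z.re * t)) := by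
  rw [norm_mul, Complex.norm_exp, Complex.norm_real, norm_of_nonneg (rpow_nonneg ht.le _)]
  simp

lemma integrableOn_rpow_mul_cexp_neg_mul {x : ℝ} {z : ℂ} (hx : 0 < x) (hz : 0 < z.re) :
    IntegrableOn (fun t : ℝ => ((t ^ (x - 1) : ℝ) : ℂ) * Complex.exp (-(z * t)))
      (Set.Ioi 0) := by
  refine Integrable.mono' (integrableOn_rpow_sub_one_mul_exp_neg_mul hx hz)
    (by fun_prop) ?_
  filter_upwards [ae_restrict_mem measurableSet_Ioi] with t ht
  exact (norm_rpow_mul_cexp_neg_mul ht z).le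

lemma differentiableOn_integral_rpow_mul_cexp_neg_mul {x : ℝ} (hx : 0 < x) :
    DifferentiableOn ℂ (fun z : ℂ => ∫ t in Set.Ioi (0 : ℝ),
      ((t ^ (x - 1) : ℝ) : ℂ) * Complex.exp (-(z * t))) {z | 0 < z.re} := by
  intro z hz
  have hz' : 0 < z.re := hz
  refine DifferentiableAt.differentiableWithinAt ?_
  refine (hasDerivAt_integral_of_dominated_loc_of_deriv_le
    (F' := fun (w : ℂ) (t : ℝ) =>
      ((t ^ (x - 1) : ℝ) : ℂ) * (Complex.exp (-(w * t)) * -(1 * (t : ℂ))))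
    (s := {w : ℂ | z.re / 2 < w.re})
    (bound := fun t : ℝ => t ^ (x + 1 - 1) * exp (-(z.re / 2 * t)))
    ?_ ?_ ?_ ?_ ?_ ?_ ?_).2.differentiableAt
  · exact (isOpen_lt continuous_const Complex.continuous_re).mem_nhds (half_lt_self hz')
  · exact Filter.Eventually.of_forall fun w => by fun_prop
  · exact integrableOn_rpow_mul_cexp_neg_mul hx hz'
  · fun_prop
  · filter_upwards [ae_restrict_mem measurableSet_Ioi] with t ht w hw
    have ht' : (0 : ℝ) < t := ht
    rw [← mul_assoc, norm_mul, norm_rpow_mul_cexp_neg_mul ht', one_mul, norm_neg,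
      Complex.norm_real, norm_of_nonneg ht'.le]
    have : t ^ (x + 1 - 1) = t ^ (x - 1) * t := by
      rw [← rpow_add_one ht'.ne']
      ring_nf
    rw [this, mul_right_comm]
    gcongr
  · exact integrableOn_rpow_sub_one_mul_exp_neg_mul (by linarith) (half_pos hz')
  · filter_upwards with t w _
    exact ((((hasDerivAt_id w).mul_const (t : ℂ)).neg).cexp).const_mul _

/-- The Gamma integral along a ray in the right half-plane. -/
theorem integral_rpow_mul_cexp_neg_mul {x : ℝ} {z : ℂ} (hx : 0 < x) (hz : 0 < z.re) :
    ∫ t in Set.Ioi (0 : ℝ), ((t ^ (x - 1) : ℝ) : ℂ) * Complex.exp (-(z * t)) =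
      (Gamma x : ℂ) * z ^ (-x : ℂ) := by
  have hopen : IsOpen {z : ℂ | 0 < z.re} := isOpen_lt continuous_const Complex.continuous_re
  refine AnalyticOnNhd.eqOn_of_preconnected_of_frequently_eq (z₀ := 1)
    ((differentiableOn_integral_rpow_mul_cexp_neg_mul hx).analyticOnNhd hopen)
    (g := fun z : ℂ => (Gamma x : ℂ) * z ^ (-x : ℂ)) (DifferentiableOn.analyticOnNhd ?_ hopen)
    (convex_halfSpace_re_gt 0).isPreconnected (by simp) ?_ hz
  · intro w hw
    exact ((differentiableAt_id.cpow (differentiableAt_const _)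
      (Or.inl hw)).const_mul _).differentiableWithinAt
  · have hreal : ∀ b : ℝ, 0 < b →
        ∫ t in Set.Ioi (0 : ℝ), ((t ^ (x - 1) : ℝ) : ℂ) * Complex.exp (-((b : ℂ) * t)) =
          (Gamma x : ℂ) * (b : ℂ) ^ (-x : ℂ) := by
      intro b hb
      rw [show (b : ℂ) ^ (-x : ℂ) = ((b ^ (-x) : ℝ) : ℂ) by
        rw [Complex.ofReal_cpow hb.le]; push_cast; rfl]
      rw [← Complex.ofReal_mul, rpow_neg hb.le, ← inv_rpow hb.le, mul_comm, ← one_div,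
        ← integral_rpow_mul_exp_neg_mul_Ioi hx hb, ← integral_complex_ofReal]
      simp
    have ht : Filter.Tendsto (fun b : ℝ => (b : ℂ)) (nhdsWithin 1 (Set.Ioi 1))
        (nhdsWithin 1 {1}ᶜ) := by
      refine tendsto_nhdsWithin_iff.2 ⟨?_, ?_⟩
      · exact (Complex.continuous_ofReal.tendsto' 1 1 (by simp)).mono_left nhdsWithin_le_nhds
      · filter_upwards [self_mem_nhdsWithin] with b hb
        simpa using (ne_of_gt hb : b ≠ 1)
    refine ht.frequently (Filter.Eventually.frequently ?_)
    filter_upwards [self_mem_nhdsWithin] with b hb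
    exact hreal b (lt_trans one_pos hb)

lemma ofReal_mul_cexp_cpow {b ψ : ℝ} (hb : 0 < b) (h₁ : -π < ψ) (h₂ : ψ ≤ π) (x : ℝ) :
    ((b : ℂ) * Complex.exp (ψ * Complex.I)) ^ (x : ℂ) =
      ((b ^ x : ℝ) : ℂ) * Complex.exp ((x * ψ : ℝ) * Complex.I) := by
  have hlog : Complex.log ((b : ℂ) * Complex.exp (ψ * Complex.I)) =
      (log b : ℂ) + ψ * Complex.I := by
    rw [Complex.log_ofReal_mul hb (Complex.exp_ne_zero _),
      Complex.log_exp (by simpa using h₁) (by simpa using h₂)]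
  rw [Complex.cpow_def_of_ne_zero (mul_ne_zero (by exact_mod_cast hb.ne') (Complex.exp_ne_zero _)),
    hlog, rpow_def_of_pos hb, Complex.ofReal_exp, ← Complex.exp_add]
  congr 1
  push_cast
  ring

/-- The Gamma integral along the ray of argument `ψ`, in polar form. -/
theorem integral_rpow_mul_cexp_ray {x b ψ : ℝ} (hx : 0 < x) (hb : 0 < b)
    (h₁ : -(π / 2) < ψ) (h₂ : ψ < π / 2) :
    ∫ t in Set.Ioi (0 : ℝ),
        ((t ^ (x - 1) : ℝ) : ℂ) * Complex.exp (-((b : ℂ) * Complex.exp (ψ * Complex.I) * t)) =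
      ((Gamma x * b ^ (-x) : ℝ) : ℂ) * Complex.exp ((-x * ψ : ℝ) * Complex.I) := by
  have hre : 0 < ((b : ℂ) * Complex.exp (ψ * Complex.I)).re := by
    rw [Complex.re_ofReal_mul, Complex.exp_ofReal_mul_I_re]
    exact mul_pos hb (cos_pos_of_mem_Ioo ⟨h₁, h₂⟩)
  rw [integral_rpow_mul_cexp_neg_mul hx hre, ← Complex.ofReal_neg,
    ofReal_mul_cexp_cpow hb (by linarith [pi_pos]) (by linarith [pi_pos])]
  push_cast
  ring

lemma exists_mul_rpow_le_add_mul {α A ε : ℝ} (hα : α ∈ Set.Ioo (0 : ℝ) 1) (hA : 0 ≤ A)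
    (hε : 0 < ε) : ∃ C : ℝ, ∀ t : ℝ, 0 < t → A * t ^ α ≤ C + ε * t := by
  obtain ⟨h0, h1⟩ := hα
  set p : ℝ := (A * ε ^ (-α)) ^ (1 / (1 - α)) with hp
  have hp0 : 0 ≤ p := by positivity
  refine ⟨(1 - α) * p, fun t ht => ?_⟩
  have h := geom_mean_le_arith_mean2_weighted h0.le (sub_nonneg.2 h1.le)
    (mul_nonneg hε.le ht.le) hp0 (by ring)
  have hpow : p ^ (1 - α) = A * ε ^ (-α) := by
    rw [hp, ← rpow_mul (by positivity), one_div_mul_cancel (by linarith), rpow_one]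
  have hcancel : ε ^ α * ε ^ (-α) = 1 := by rw [← rpow_add hε]; simp
  rw [hpow, mul_rpow hε.le ht.le] at h
  have hle : α * (ε * t) ≤ ε * t := by nlinarith [mul_pos hε ht]
  calc A * t ^ α = ε ^ α * t ^ α * (A * ε ^ (-α)) := by linear_combination (-(A * t ^ α)) * hcancel
    _ ≤ _ := by linarith

lemma Gamma_mul_sin_pi_mul {s : ℝ} (hs : 0 < s) :
    Gamma s * sin (π * s) = π / Gamma (1 - s) := by
  have h := Gamma_mul_Gamma_one_sub s
  have hG := (Gamma_pos_of_pos hs).ne'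
  by_cases hsin : sin (π * s) = 0
  · rw [hsin, div_zero] at h
    rw [hsin, (mul_eq_zero.1 h).resolve_left hG]
    simp
  · have h1 : Gamma (1 - s) ≠ 0 := by
      intro h1
      rw [h1, mul_zero] at h
      exact div_ne_zero pi_ne_zero hsin h.symm
    rw [eq_div_iff hsin] at h
    rw [eq_div_iff h1]
    linarith

/-- The integrand of the Hankel-type representation of the Mainardi function, along the ray of
argument `π - φ`. -/
noncomputable def mainardiKernel (α φ r t : ℝ) : ℂ :=
  ((t ^ (α - 1) : ℝ) : ℂ) *
    Complex.exp (-(((1 : ℝ) : ℂ) * Complex.exp ((-φ : ℝ) * Complex.I) * t)) *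
    Complex.exp (-(((t ^ α : ℝ) : ℂ) * Complex.exp (φ * Complex.I) * r))

lemma norm_cexp_neg_ray (b ψ t : ℝ) :
    ‖Complex.exp (-((b : ℂ) * Complex.exp (ψ * Complex.I) * t))‖ = exp (-(b * cos ψ * t)) := by
  rw [Complex.norm_exp, Complex.neg_re, Complex.re_mul_ofReal, Complex.re_ofReal_mul,
    Complex.exp_ofReal_mul_I_re]

lemma norm_mainardiKernel {t : ℝ} (ht : 0 < t) (α φ r : ℝ) :
    ‖mainardiKernel α φ r t‖ =
      t ^ (α - 1) * exp (-(cos φ * t)) * exp (-(t ^ α * cos φ * r)) := by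
  rw [mainardiKernel, norm_mul, norm_mul, norm_cexp_neg_ray, norm_cexp_neg_ray,
    Complex.norm_real, norm_of_nonneg (rpow_nonneg ht.le _), cos_neg, one_mul]

lemma measurable_uncurry_mainardiKernel (α φ : ℝ) :
    Measurable (Function.uncurry (mainardiKernel α φ)) := by
  unfold mainardiKernel Function.uncurry
  fun_prop

lemma measurable_mainardiKernel (α φ r : ℝ) : Measurable (mainardiKernel α φ r) := by
  unfold mainardiKernel
  fun_prop

lemma integrableOn_mainardiKernel {α φ r : ℝ} (hα : 0 < α) (hφ : 0 < cos φ) (hr : 0 ≤ r) :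
    IntegrableOn (mainardiKernel α φ r) (Set.Ioi 0) := by
  refine Integrable.mono' (integrableOn_rpow_sub_one_mul_exp_neg_mul hα hφ)
    (measurable_mainardiKernel α φ r).aestronglyMeasurable ?_
  filter_upwards [ae_restrict_mem measurableSet_Ioi] with t ht
  have ht' : (0 : ℝ) < t := ht
  rw [norm_mainardiKernel ht']
  refine mul_le_of_le_one_right (by positivity) (exp_le_one_iff.2 ?_)
  have : 0 ≤ t ^ α * cos φ * r := by positivity
  linarith

/-- The angle at which the two exponentials of `mainardiKernel` decay at the same rate. -/
noncomputable def mainardiAngle (α : ℝ) : ℝ := π * α / (1 + α)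

lemma mainardiAngle_mul {α : ℝ} (hα : 0 < α) : mainardiAngle α * (1 + α) = π * α := by
  rw [mainardiAngle]
  field_simp

lemma mainardiAngle_mem {α : ℝ} (hα : α ∈ Set.Ioo (0 : ℝ) 1) :
    mainardiAngle α ∈ Set.Ioo (-(π / 2)) (π / 2) := by
  obtain ⟨h0, h1⟩ := hα
  have hpi := pi_pos
  have hpos : 0 < mainardiAngle α := by rw [mainardiAngle]; positivity
  refine ⟨by linarith, ?_⟩
  rw [mainardiAngle, div_lt_div_iff₀ (by linarith) two_pos]
  nlinarith

lemma cos_mainardiAngle_pos {α : ℝ} (hα : α ∈ Set.Ioo (0 : ℝ) 1) : 0 < cos (mainardiAngle α) :=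
  cos_pos_of_mem_Ioo (mainardiAngle_mem hα)

/-- The complex contour integral whose imaginary part is `π` times the Mainardi function. -/
noncomputable def mainardiContour (α r : ℝ) : ℂ :=
  Complex.exp (mainardiAngle α * Complex.I) *
    ∫ t in Set.Ioi (0 : ℝ), mainardiKernel α (mainardiAngle α) r t

lemma rpow_mul_succ_sub_one {t : ℝ} (ht : 0 < t) (α : ℝ) (n : ℕ) :
    t ^ (α * (n + 1) - 1) = t ^ (α - 1) * (t ^ α) ^ n := by
  rw [← rpow_natCast, ← rpow_mul ht.le, ← rpow_add ht]
  ring_nf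

lemma integrableOn_rpow_mul_exp_neg_mul_add_rpow {α A b : ℝ} (hα : α ∈ Set.Ioo (0 : ℝ) 1)
    (hA : 0 ≤ A) (hb : 0 < b) :
    IntegrableOn (fun t : ℝ => t ^ (α - 1) * exp (-(b * t)) * exp (A * t ^ α)) (Set.Ioi 0) := by
  obtain ⟨C, hC⟩ := exists_mul_rpow_le_add_mul hα hA (half_pos hb)
  refine Integrable.mono'
    ((integrableOn_rpow_sub_one_mul_exp_neg_mul hα.1 (half_pos hb)).mul_const (exp C))
    (by fun_prop) ?_
  filter_upwards [ae_restrict_mem measurableSet_Ioi] with t ht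
  have ht' : (0 : ℝ) < t := ht
  rw [norm_of_nonneg (by positivity), mul_assoc, mul_assoc, ← exp_add, ← exp_add]
  refine mul_le_mul_of_nonneg_left (exp_le_exp.2 ?_) (by positivity)
  linarith [hC t ht']

lemma hasSum_integral_mainardiKernel {α φ : ℝ} (hα : α ∈ Set.Ioo (0 : ℝ) 1)
    (hφ : φ ∈ Set.Ioo (-(π / 2)) (π / 2)) (r : ℝ) :
    HasSum (fun n : ℕ => ((Gamma (α * (n + 1)) * ((-r) ^ n / n.factorial) : ℝ) : ℂ) *
        Complex.exp ((n * φ + α * (n + 1) * φ : ℝ) * Complex.I))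
      (∫ t in Set.Ioi (0 : ℝ), mainardiKernel α φ r t) := by
  have hc : 0 < cos φ := cos_pos_of_mem_Ioo hφ
  let w : ℕ → ℂ := fun n => (-(Complex.exp (φ * Complex.I)) * r) ^ n / n.factorial
  have hw : ∀ n, ‖w n‖ = |r| ^ n / n.factorial := fun n => by
    simp [w, Complex.norm_exp_ofReal_mul_I]
  have hsum := hasSum_integral_of_dominated_convergence (μ := volume.restrict (Set.Ioi (0 : ℝ)))
    (F := fun (n : ℕ) (t : ℝ) => (((t ^ (α * (n + 1) - 1) : ℝ) : ℂ) *
      Complex.exp (-(((1 : ℝ) : ℂ) * Complex.exp ((-φ : ℝ) * Complex.I) * t))) * w n)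
    (f := mainardiKernel α φ r)
    (fun (n : ℕ) (t : ℝ) => t ^ (α - 1) * exp (-(cos φ * t)) * ((|r| * t ^ α) ^ n / n.factorial))
    (fun n => by fun_prop) ?_ ?_ ?_ ?_
  · refine (congrArg (HasSum · _) (funext fun n => ?_)).mpr hsum
    have hn : 0 < α * ((n : ℝ) + 1) := mul_pos hα.1 (by positivity)
    rw [integral_mul_const, integral_rpow_mul_cexp_ray hn one_pos
      (by linarith [hφ.2]) (by linarith [hφ.1])]
    have hexp : Complex.exp ((n * φ + α * (n + 1) * φ : ℝ) * Complex.I) =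
        Complex.exp ((-(α * (n + 1)) * -φ : ℝ) * Complex.I) *
          Complex.exp (φ * Complex.I) ^ n := by
      rw [← Complex.exp_nat_mul, ← Complex.exp_add]
      congr 1
      push_cast
      ring
    rw [hexp]
    simp only [w, one_rpow, mul_one]
    push_cast
    rw [show (-(Complex.exp (φ * Complex.I)) * (r : ℂ)) =
      Complex.exp (φ * Complex.I) * (-r) by ring,
      mul_pow]
    ring
  · intro n
    filter_upwards [ae_restrict_mem measurableSet_Ioi] with t ht
    have ht' : (0 : ℝ) < t := ht
    rw [norm_mul, norm_mul, norm_cexp_neg_ray, hw, Complex.norm_real,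
      norm_of_nonneg (rpow_nonneg ht'.le _), rpow_mul_succ_sub_one ht', cos_neg, one_mul, mul_pow]
    apply le_of_eq
    ring
  · filter_upwards with t
    exact (summable_pow_div_factorial _).mul_left _
  · have h : ∀ t : ℝ, ∑' n : ℕ, t ^ (α - 1) * exp (-(cos φ * t)) *
        ((|r| * t ^ α) ^ n / n.factorial) =
        t ^ (α - 1) * exp (-(cos φ * t)) * exp (|r| * t ^ α) := fun t => by
      rw [tsum_mul_left, exp_eq_exp_ℝ, NormedSpace.exp_eq_tsum_div]
    simp only [h]
    exact integrableOn_rpow_mul_exp_neg_mul_add_rpow hα (abs_nonneg r) hc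
  · filter_upwards [ae_restrict_mem measurableSet_Ioi] with t ht
    have ht' : (0 : ℝ) < t := ht
    have h := (NormedSpace.expSeries_div_hasSum_exp
      (-(((t ^ α : ℝ) : ℂ) * Complex.exp (φ * Complex.I) * r))).mul_left
      (((t ^ (α - 1) : ℝ) : ℂ) *
        Complex.exp (-(((1 : ℝ) : ℂ) * Complex.exp ((-φ : ℝ) * Complex.I) * t)))
    rw [← Complex.exp_eq_exp_ℂ] at h
    rw [mainardiKernel]
    refine (congrArg (HasSum · _) (funext fun n => ?_)).mpr h
    rw [rpow_mul_succ_sub_one ht']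
    simp only [w]
    rw [show -(((t ^ α : ℝ) : ℂ) * Complex.exp (φ * Complex.I) * r) =
      ((t ^ α : ℝ) : ℂ) * (-(Complex.exp (φ * Complex.I)) * r) by ring, mul_pow _ _ n]
    push_cast
    ring

/-- The Mainardi function as the imaginary part of a contour integral. -/
theorem mainardi_eq_im_mainardiContour {α : ℝ} (hα : α ∈ Set.Ioo (0 : ℝ) 1) (r : ℝ) :
    mainardi α r = (mainardiContour α r).im / π := by
  have h := (hasSum_integral_mainardiKernel hα (mainardiAngle_mem hα) r).mul_left
    (Complex.exp (mainardiAngle α * Complex.I))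
  refine HasSum.tsum_eq ?_
  refine (congrArg (HasSum · _) (funext fun n => ?_)).mpr ((Complex.hasSum_im h).div_const π)
  have hn : 0 < α * ((n : ℝ) + 1) := mul_pos hα.1 (by positivity)
  rw [mul_left_comm, ← Complex.exp_add, Complex.im_ofReal_mul,
    show (mainardiAngle α : ℂ) * Complex.I +
      ((n * mainardiAngle α + α * (n + 1) * mainardiAngle α : ℝ) : ℂ) * Complex.I =
      ((mainardiAngle α * (1 + α) * (n + 1) : ℝ) : ℂ) * Complex.I by push_cast; ring,
    Complex.exp_ofReal_mul_I_im, mainardiAngle_mul hα.1,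
    show π * α * ((n : ℝ) + 1) = π * (α * (n + 1)) by ring, mul_right_comm,
    Gamma_mul_sin_pi_mul hn, show -α * (n : ℝ) + 1 - α = 1 - α * (n + 1) by ring]
  field_simp

lemma norm_cexp_sub_sum_le_of_re_nonpos {z : ℂ} (hz : z.re ≤ 0) (N : ℕ) :
    ‖Complex.exp z - ∑ k ∈ Finset.range N, z ^ k / k.factorial‖ ≤ 4 * ‖z‖ ^ N := by
  have he : exp 1 ≤ 3 := by linarith [exp_one_lt_d9]
  have hpow : 0 ≤ ‖z‖ ^ N := by positivity
  rcases le_total ‖z‖ 1 with h | h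
  · calc _ ≤ ‖z‖ ^ N * exp ‖z‖ := Complex.norm_exp_sub_sum_le_norm_mul_exp z N
      _ ≤ ‖z‖ ^ N * exp 1 := by gcongr
      _ ≤ 4 * ‖z‖ ^ N := by nlinarith
  · have hexp : ‖Complex.exp z‖ ≤ ‖z‖ ^ N := by
      rw [Complex.norm_exp]
      exact (exp_le_one_iff.2 hz).trans (one_le_pow₀ h)
    have hsum : ‖∑ k ∈ Finset.range N, z ^ k / (k.factorial : ℂ)‖ ≤ ‖z‖ ^ N * exp 1 := by
      calc _ ≤ ∑ k ∈ Finset.range N, ‖z ^ k / (k.factorial : ℂ)‖ := norm_sum_le _ _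
        _ ≤ ∑ k ∈ Finset.range N, ‖z‖ ^ N * ((1 : ℝ) ^ k / k.factorial) := by
          refine Finset.sum_le_sum fun k hk => ?_
          rw [norm_div, norm_pow, Complex.norm_natCast, one_pow, mul_one_div]
          gcongr
          exact (Finset.mem_range.1 hk).le
        _ = ‖z‖ ^ N * ∑ k ∈ Finset.range N, (1 : ℝ) ^ k / k.factorial := by rw [Finset.mul_sum]
        _ ≤ _ := by
          gcongr
          exact sum_le_exp_of_nonneg zero_le_one N
    calc _ ≤ _ := norm_sub_le _ _
      _ ≤ ‖z‖ ^ N + ‖z‖ ^ N * exp 1 := add_le_add hexp hsum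
      _ ≤ 4 * ‖z‖ ^ N := by nlinarith

lemma integrableOn_rpow_mul_pow_mul_cexp_rpow {α φ r : ℝ} (hα : 0 < α) (hφ : 0 < cos φ)
    (hr : 0 < r) (k : ℕ) :
    IntegrableOn (fun t : ℝ => ((t ^ (α - 1) * t ^ k : ℝ) : ℂ) *
      Complex.exp (-(((t ^ α : ℝ) : ℂ) * Complex.exp (φ * Complex.I) * r))) (Set.Ioi 0) := by
  have h := integrableOn_rpow_mul_exp_neg_mul_rpow (p := α) (s := α - 1 + k) (b := r * cos φ)
    (by linarith [(k.cast_nonneg : (0 : ℝ) ≤ k)]) hα (mul_pos hr hφ)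
  refine Integrable.mono' h (by fun_prop) ?_
  filter_upwards [ae_restrict_mem measurableSet_Ioi] with t ht
  have ht' : (0 : ℝ) < t := ht
  rw [norm_mul, norm_cexp_neg_ray, Complex.norm_real, norm_of_nonneg (by positivity),
    rpow_add_natCast ht'.ne']
  apply le_of_eq
  ring_nf

lemma integral_rpow_mul_pow_mul_cexp_rpow {α φ r : ℝ} (hα : 0 < α)
    (hφ : φ ∈ Set.Ioo (-(π / 2)) (π / 2)) (hr : 0 < r) (k : ℕ) :
    ∫ t in Set.Ioi (0 : ℝ), ((t ^ (α - 1) * t ^ k : ℝ) : ℂ) *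
        Complex.exp (-(((t ^ α : ℝ) : ℂ) * Complex.exp (φ * Complex.I) * r)) =
      ((α⁻¹ * (Gamma (k / α + 1) * r ^ (-(k / α + 1))) : ℝ) : ℂ) *
        Complex.exp ((-(k / α + 1) * φ : ℝ) * Complex.I) := by
  have hx : 0 < (k : ℝ) / α + 1 := by positivity
  have h := integral_rpow_mul_cexp_ray hx hr hφ.1 hφ.2
  rw [← integral_comp_rpow_Ioi_of_pos hα] at h
  rw [Complex.ofReal_mul, mul_assoc, ← h, ← integral_const_mul]
  refine setIntegral_congr_fun measurableSet_Ioi fun t ht => ?_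
  have ht' : (0 : ℝ) < t := ht
  have hpow : (t ^ α) ^ ((k : ℝ) / α + 1 - 1) = t ^ k := by
    rw [← rpow_mul ht'.le, ← rpow_natCast]
    congr 1
    field_simp
    ring
  have hα' : (α : ℂ) ≠ 0 := by exact_mod_cast hα.ne'
  simp only [hpow, Complex.real_smul]
  push_cast
  field_simp

lemma im_mainardiContour_monomial_eq_zero {α r : ℝ} (hα : α ∈ Set.Ioo (0 : ℝ) 1) (hr : 0 < r)
    (k : ℕ) :
    (Complex.exp (mainardiAngle α * Complex.I) * ∫ t in Set.Ioi (0 : ℝ),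
      (-Complex.exp ((-mainardiAngle α : ℝ) * Complex.I)) ^ k / k.factorial *
        (((t ^ (α - 1) * t ^ k : ℝ) : ℂ) * Complex.exp
          (-(((t ^ α : ℝ) : ℂ) * Complex.exp (mainardiAngle α * Complex.I) * r)))).im = 0 := by
  rw [integral_const_mul, integral_rpow_mul_pow_mul_cexp_rpow hα.1 (mainardiAngle_mem hα) hr]
  have hphase : Complex.exp (mainardiAngle α * Complex.I) *
      (Complex.exp ((-mainardiAngle α : ℝ) * Complex.I) ^ k *
        Complex.exp ((-(k / α + 1) * mainardiAngle α : ℝ) * Complex.I)) =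
      Complex.exp ((-(k * π) : ℝ) * Complex.I) := by
    rw [← Complex.exp_nat_mul, ← Complex.exp_add, ← Complex.exp_add]
    congr 1
    have h : mainardiAngle α + (k * -mainardiAngle α + -(k / α + 1) * mainardiAngle α) =
        -(k * π) := by
      have hα0 := hα.1.ne'
      have h1 := mainardiAngle_mul hα.1
      field_simp
      linear_combination (-(k : ℝ)) * h1
    rw [← h]
    push_cast
    ring
  rw [neg_pow, show ∀ a b c d e f : ℂ, a * (b * c / d * (e * f)) = a * (c * f) * (b / d * e) by
    intros; ring, hphase, show ((-1 : ℂ) ^ k / (k.factorial : ℂ) *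
      ((α⁻¹ * (Gamma (k / α + 1) * r ^ (-(k / α + 1))) : ℝ) : ℂ)) =
      (((-1) ^ k / (k.factorial : ℝ) *
        (α⁻¹ * (Gamma (k / α + 1) * r ^ (-(k / α + 1)))) : ℝ) : ℂ) by push_cast; ring,
    Complex.im_mul_ofReal, Complex.exp_ofReal_mul_I_im, sin_neg, sin_nat_mul_pi]
  simp

/-- The Mainardi function decays faster than any power at infinity. -/
theorem exists_abs_mainardi_le_rpow {α : ℝ} (hα : α ∈ Set.Ioo (0 : ℝ) 1) (N : ℕ) :
    ∃ C : ℝ, ∀ r : ℝ, 0 < r → |mainardi α r| ≤ C * r ^ (-(N / α + 1)) := by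
  have hc := cos_mainardiAngle_pos hα
  have hα0 := hα.1
  set φ := mainardiAngle α with hφ
  set c := cos φ with hcdef
  refine ⟨π⁻¹ * (4 * (c ^ (-(N / α + 1)) * (1 / α) * Gamma (N / α + 1))), fun r hr => ?_⟩
  let q : ℕ → ℝ → ℂ := fun k t =>
    (-Complex.exp ((-φ : ℝ) * Complex.I)) ^ k / k.factorial *
      (((t ^ (α - 1) * t ^ k : ℝ) : ℂ) * Complex.exp
        (-(((t ^ α : ℝ) : ℂ) * Complex.exp (φ * Complex.I) * r)))
  have hq : ∀ k, IntegrableOn (q k) (Set.Ioi 0) := fun k =>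
    (integrableOn_rpow_mul_pow_mul_cexp_rpow hα0 hc hr k).const_mul _
  have hK := integrableOn_mainardiKernel hα0 hc hr.le
  have him : (mainardiContour α r).im = (Complex.exp (φ * Complex.I) *
      ∫ t in Set.Ioi (0 : ℝ),
        (mainardiKernel α φ r t - ∑ k ∈ Finset.range N, q k t)).im := by
    rw [integral_sub hK (integrable_finsetSum _ fun k _ => hq k),
      integral_finsetSum _ fun k _ => hq k, mul_sub, Finset.mul_sum, Complex.sub_im,
      Complex.im_sum, Finset.sum_eq_zero fun k _ =>
        im_mainardiContour_monomial_eq_zero hα hr k, sub_zero, mainardiContour]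
  have hbound : ∀ t ∈ Set.Ioi (0 : ℝ),
      ‖mainardiKernel α φ r t - ∑ k ∈ Finset.range N, q k t‖ ≤
        4 * (t ^ (α - 1 + N) * exp (-(r * c) * t ^ α)) := by
    intro t ht
    have ht' : (0 : ℝ) < t := ht
    set z : ℂ := -(((1 : ℝ) : ℂ) * Complex.exp ((-φ : ℝ) * Complex.I) * t) with hz
    have hzre : z.re ≤ 0 := by
      rw [hz, Complex.neg_re, Complex.re_mul_ofReal, Complex.re_ofReal_mul,
        Complex.exp_ofReal_mul_I_re, cos_neg]
      have : 0 ≤ c * t := by positivity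
      linarith
    have hznorm : ‖z‖ = t := by
      rw [hz, norm_neg, norm_mul, norm_mul, Complex.norm_exp_ofReal_mul_I, Complex.norm_real,
        Complex.norm_real, norm_one, norm_of_nonneg ht'.le]
      ring
    have heq : mainardiKernel α φ r t - ∑ k ∈ Finset.range N, q k t =
        ((t ^ (α - 1) : ℝ) : ℂ) *
          (Complex.exp z - ∑ k ∈ Finset.range N, z ^ k / k.factorial) *
          Complex.exp (-(((t ^ α : ℝ) : ℂ) * Complex.exp (φ * Complex.I) * r)) := by
      rw [mainardiKernel, mul_sub, sub_mul, Finset.mul_sum, Finset.sum_mul]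
      congr 1
      refine Finset.sum_congr rfl fun k _ => ?_
      rw [hz, show -(((1 : ℝ) : ℂ) * Complex.exp ((-φ : ℝ) * Complex.I) * t) =
        -Complex.exp ((-φ : ℝ) * Complex.I) * t by push_cast; ring, mul_pow]
      simp only [q]
      push_cast
      ring
    rw [heq, norm_mul, norm_mul, norm_cexp_neg_ray, Complex.norm_real,
      norm_of_nonneg (rpow_nonneg ht'.le _), rpow_add_natCast ht'.ne']
    calc t ^ (α - 1) * ‖Complex.exp z - ∑ k ∈ Finset.range N, z ^ k / k.factorial‖ *
          exp (-(t ^ α * cos φ * r))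
        ≤ t ^ (α - 1) * (4 * ‖z‖ ^ N) * exp (-(t ^ α * cos φ * r)) := by
          gcongr
          exact norm_cexp_sub_sum_le_of_re_nonpos hzre N
      _ = _ := by
          rw [hznorm, ← hcdef]
          ring_nf
  have hN : -1 < α - 1 + (N : ℝ) := by linarith [(N.cast_nonneg : (0 : ℝ) ≤ N)]
  have hint : ‖∫ t in Set.Ioi (0 : ℝ),
      (mainardiKernel α φ r t - ∑ k ∈ Finset.range N, q k t)‖ ≤
      4 * ((r * c) ^ (-(N / α + 1)) * (1 / α) * Gamma (N / α + 1)) := by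
    have hval := integral_rpow_mul_exp_neg_mul_rpow hα0 hN (mul_pos hr hc)
    have e1 : (α - 1 + N + 1) / α = N / α + 1 := by field_simp; ring
    rw [neg_div, e1] at hval
    rw [← hval, ← integral_const_mul]
    refine norm_integral_le_of_norm_le
      ((integrableOn_rpow_mul_exp_neg_mul_rpow hN hα0 (mul_pos hr hc)).const_mul 4) ?_
    filter_upwards [ae_restrict_mem measurableSet_Ioi] with t ht using hbound t ht
  rw [mainardi_eq_im_mainardiContour hα, him, abs_div, abs_of_pos pi_pos, div_eq_inv_mul,
    mul_assoc]
  gcongr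
  refine (Complex.abs_im_le_norm _).trans ?_
  rw [norm_mul, Complex.norm_exp_ofReal_mul_I, one_mul]
  refine hint.trans (le_of_eq ?_)
  rw [mul_rpow hr.le hc.le]
  ring

lemma exists_abs_mainardi_le {α : ℝ} (hα : α ∈ Set.Ioo (0 : ℝ) 1) :
    ∃ C : ℝ, ∀ r : ℝ, 0 < r → |mainardi α r| ≤ C := by
  have hc := cos_mainardiAngle_pos hα
  refine ⟨(∫ t in Set.Ioi (0 : ℝ), t ^ (α - 1) * exp (-(cos (mainardiAngle α) * t))) / π,
    fun r hr => ?_⟩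
  rw [mainardi_eq_im_mainardiContour hα, abs_div, abs_of_pos pi_pos]
  gcongr
  refine (Complex.abs_im_le_norm _).trans ?_
  rw [mainardiContour, norm_mul, Complex.norm_exp_ofReal_mul_I, one_mul]
  refine norm_integral_le_of_norm_le (integrableOn_rpow_sub_one_mul_exp_neg_mul hα.1 hc) ?_
  filter_upwards [ae_restrict_mem measurableSet_Ioi] with t ht
  have ht' : (0 : ℝ) < t := ht
  rw [norm_mainardiKernel ht']
  refine mul_le_of_le_one_right (by positivity) (exp_le_one_iff.2 ?_)
  have : 0 ≤ t ^ α * cos (mainardiAngle α) * r := by positivity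
  linarith

lemma measurable_mainardi {α : ℝ} (hα : α ∈ Set.Ioo (0 : ℝ) 1) : Measurable (mainardi α) := by
  have h : mainardi α = fun r => (mainardiContour α r).im / π :=
    funext (mainardi_eq_im_mainardiContour hα)
  have hint : Measurable fun r : ℝ =>
      ∫ t in Set.Ioi (0 : ℝ), mainardiKernel α (mainardiAngle α) r t :=
    ((measurable_uncurry_mainardiKernel α
      (mainardiAngle α)).stronglyMeasurable.integral_prod_right).measurable
  rw [h]
  unfold mainardiContour
  exact (Complex.measurable_im.comp (hint.const_mul _)).div_const π

lemma locallyIntegrableOn_mainardi {α : ℝ} (hα : α ∈ Set.Ioo (0 : ℝ) 1) :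
    LocallyIntegrableOn (fun r : ℝ => (mainardi α r : ℂ)) (Set.Ioi 0) := by
  obtain ⟨C, hC⟩ := exists_abs_mainardi_le hα
  refine (locallyIntegrableOn_iff isOpen_Ioi.isLocallyClosed).2 fun k hk hkc => ?_
  refine Measure.integrableOn_of_bounded (M := C) hkc.measure_lt_top.ne
    (Complex.measurable_ofReal.comp (measurable_mainardi hα)).aestronglyMeasurable ?_
  filter_upwards [ae_restrict_mem hkc.measurableSet] with r hr
  simpa using hC r (hk hr)

lemma integral_rpow_mul_mainardiKernel {α φ s t : ℝ} (hs : 0 < s) (ht : 0 < t)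
    (hφ : φ ∈ Set.Ioo (-(π / 2)) (π / 2)) :
    ∫ r in Set.Ioi (0 : ℝ), ((r ^ (s - 1) : ℝ) : ℂ) * mainardiKernel α φ r t =
      (((Gamma s : ℝ) : ℂ) * Complex.exp ((-s * φ : ℝ) * Complex.I)) *
      (((t ^ (α * (1 - s) - 1) : ℝ) : ℂ) *
        Complex.exp (-(((1 : ℝ) : ℂ) * Complex.exp ((-φ : ℝ) * Complex.I) * t))) := by
  unfold mainardiKernel
  simp only [mul_left_comm (((_ ^ (s - 1) : ℝ) : ℂ))]
  rw [integral_const_mul, integral_rpow_mul_cexp_ray hs (rpow_pos_of_pos ht α) hφ.1 hφ.2]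
  have hpow : t ^ (α * (1 - s) - 1) = t ^ (α - 1) * (t ^ α) ^ (-s) := by
    rw [← rpow_mul ht.le, ← rpow_add ht]
    ring_nf
  rw [hpow]
  push_cast
  ring

lemma integrable_rpow_mul_mainardiKernel {α φ s : ℝ} (hα : 0 < α) (hs : s ∈ Set.Ioo (0 : ℝ) 1)
    (hφ : φ ∈ Set.Ioo (-(π / 2)) (π / 2)) :
    Integrable (Function.uncurry fun r t : ℝ => ((r ^ (s - 1) : ℝ) : ℂ) * mainardiKernel α φ r t)
      ((volume.restrict (Set.Ioi (0 : ℝ))).prod (volume.restrict (Set.Ioi (0 : ℝ)))) := by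
  have hc : 0 < cos φ := cos_pos_of_mem_Ioo hφ
  have hmeas : Measurable (Function.uncurry fun r t : ℝ =>
      ((r ^ (s - 1) : ℝ) : ℂ) * mainardiKernel α φ r t) := by
    unfold mainardiKernel Function.uncurry
    fun_prop
  have hnorm : ∀ t ∈ Set.Ioi (0 : ℝ), ∀ r ∈ Set.Ioi (0 : ℝ),
      ‖((r ^ (s - 1) : ℝ) : ℂ) * mainardiKernel α φ r t‖ =
        (t ^ (α - 1) * exp (-(cos φ * t))) *
          (r ^ (s - 1) * exp (-(t ^ α * cos φ * r))) := by
    intro t ht r hr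
    rw [norm_mul, norm_mainardiKernel ht, Complex.norm_real,
      norm_of_nonneg (rpow_nonneg (le_of_lt hr) _)]
    ring
  refine (integrable_prod_iff' hmeas.aestronglyMeasurable).2 ⟨?_, ?_⟩
  · filter_upwards [ae_restrict_mem measurableSet_Ioi] with t ht
    refine Integrable.mono' ((integrableOn_rpow_sub_one_mul_exp_neg_mul hs.1
      (mul_pos (rpow_pos_of_pos ht α) hc)).const_mul (t ^ (α - 1) * exp (-(cos φ * t))))
      (hmeas.of_uncurry_right).aestronglyMeasurable ?_
    filter_upwards [ae_restrict_mem measurableSet_Ioi] with r hr using (hnorm t ht r hr).le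
  · have hx : 0 < α * (1 - s) := mul_pos hα (by linarith [hs.2])
    refine ((integrableOn_rpow_sub_one_mul_exp_neg_mul hx hc).const_mul
      (Gamma s * cos φ ^ (-s))).congr ?_
    filter_upwards [ae_restrict_mem measurableSet_Ioi] with t ht
    have ht' : (0 : ℝ) < t := ht
    have hb : 0 < t ^ α * cos φ := by positivity
    simp only [Function.uncurry_apply_pair]
    rw [setIntegral_congr_fun measurableSet_Ioi (hnorm t ht), integral_const_mul,
      integral_rpow_mul_exp_neg_mul_Ioi hs.1 hb, one_div, inv_rpow hb.le, ← rpow_neg hb.le,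
      mul_rpow (by positivity) hc.le, ← rpow_mul ht'.le,
      show α * (1 - s) - 1 = α - 1 + α * -s by ring, rpow_add ht']
    ring

/-- The Mellin transform of the Mainardi function on the interval where Fubini applies. -/
theorem integral_rpow_mul_mainardi_of_mem_Ioo {α s : ℝ} (hα : α ∈ Set.Ioo (0 : ℝ) 1)
    (hs : s ∈ Set.Ioo (0 : ℝ) 1) :
    ∫ r in Set.Ioi (0 : ℝ), r ^ (s - 1) * mainardi α r =
      Gamma s / Gamma (α * (s - 1) + 1) := by
  have hφ := mainardiAngle_mem hα
  set φ := mainardiAngle α with hφdef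
  have hx : 0 < α * (1 - s) := mul_pos hα.1 (by linarith [hs.2])
  have hI := integrable_rpow_mul_mainardiKernel hα.1 hs hφ
  have hswap : ∫ r in Set.Ioi (0 : ℝ), ((r ^ (s - 1) : ℝ) : ℂ) * mainardiContour α r =
      ((Gamma s * Gamma (α * (1 - s)) : ℝ) : ℂ) *
        Complex.exp ((π * (α * (1 - s)) : ℝ) * Complex.I) := by
    calc _ = Complex.exp (φ * Complex.I) * ∫ r in Set.Ioi (0 : ℝ), ∫ t in Set.Ioi (0 : ℝ),
          ((r ^ (s - 1) : ℝ) : ℂ) * mainardiKernel α φ r t := by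
          simp only [integral_const_mul]
          rw [← integral_const_mul]
          simp only [mainardiContour, mul_left_comm, hφdef]
      _ = Complex.exp (φ * Complex.I) * ∫ t in Set.Ioi (0 : ℝ),
          (((Gamma s : ℝ) : ℂ) * Complex.exp ((-s * φ : ℝ) * Complex.I)) *
          (((t ^ (α * (1 - s) - 1) : ℝ) : ℂ) *
            Complex.exp (-(((1 : ℝ) : ℂ) * Complex.exp ((-φ : ℝ) * Complex.I) * t))) := by
          rw [integral_integral_swap hI]
          congr 1
          exact setIntegral_congr_fun measurableSet_Ioi fun t ht =>
            integral_rpow_mul_mainardiKernel hs.1 ht hφ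
      _ = _ := by
          rw [integral_const_mul, integral_rpow_mul_cexp_ray hx one_pos (by linarith [hφ.2])
            (by linarith [hφ.1]), one_rpow, mul_one]
          have hphase : Complex.exp ((π * (α * (1 - s)) : ℝ) * Complex.I) =
              Complex.exp (φ * Complex.I) * Complex.exp ((-s * φ : ℝ) * Complex.I) *
                Complex.exp ((-(α * (1 - s)) * -φ : ℝ) * Complex.I) := by
            rw [← mul_assoc, ← mainardiAngle_mul hα.1, ← Complex.exp_add, ← Complex.exp_add]
            congr 1
            push_cast
            ring
          rw [hphase]
          push_cast
          ring
  have hint : Integrable (fun r : ℝ => ((r ^ (s - 1) : ℝ) : ℂ) * mainardiContour α r)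
      (volume.restrict (Set.Ioi 0)) := by
    refine (hI.integral_prod_left.const_mul (Complex.exp (φ * Complex.I))).congr ?_
    filter_upwards with r
    simp only [Function.uncurry_apply_pair]
    rw [integral_const_mul, mainardiContour]
    ring
  have him := integral_im hint
  rw [hswap] at him
  have hval : ∀ r : ℝ, r ^ (s - 1) * mainardi α r =
      RCLike.im (((r ^ (s - 1) : ℝ) : ℂ) * mainardiContour α r) / π := fun r => by
    rw [mainardi_eq_im_mainardiContour hα, RCLike.im_eq_complex_im, Complex.im_ofReal_mul]
    ring
  simp only [hval]
  rw [integral_div, him, RCLike.im_eq_complex_im, Complex.im_ofReal_mul,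
    Complex.exp_ofReal_mul_I_im, mul_assoc, Gamma_mul_sin_pi_mul hx,
    show 1 - α * (1 - s) = α * (s - 1) + 1 by ring]
  field_simp

lemma differentiableOn_mellin_mainardi {α : ℝ} (hα : α ∈ Set.Ioo (0 : ℝ) 1) :
    DifferentiableOn ℂ (mellin fun r : ℝ => (mainardi α r : ℂ)) {s | 0 < s.re} := by
  intro s hs
  obtain ⟨N, hN⟩ := exists_nat_gt s.re
  obtain ⟨C, hC⟩ := exists_abs_mainardi_le_rpow hα N
  obtain ⟨B, hB⟩ := exists_abs_mainardi_le hα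
  have hle : (N : ℝ) ≤ N / α := by
    rw [le_div_iff₀ hα.1]
    exact mul_le_of_le_one_right N.cast_nonneg hα.2.le
  refine (mellin_differentiableAt_of_isBigO_rpow (a := N / α + 1) (b := 0)
    (locallyIntegrableOn_mainardi hα) ?_ (by linarith) ?_ hs).differentiableWithinAt
  · refine Asymptotics.IsBigO.of_bound C ?_
    filter_upwards [Filter.eventually_gt_atTop 0] with r hr
    rw [Complex.norm_real, norm_of_nonneg (rpow_nonneg hr.le _)]
    exact hC r hr
  · refine Asymptotics.IsBigO.of_bound B ?_
    filter_upwards [self_mem_nhdsWithin] with r hr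
    simpa using hB r hr

lemma mellin_mainardi_ofReal (α s : ℝ) :
    mellin (fun r : ℝ => (mainardi α r : ℂ)) s =
      ((∫ r in Set.Ioi (0 : ℝ), r ^ (s - 1) * mainardi α r : ℝ) : ℂ) := by
  rw [mellin, ← integral_complex_ofReal]
  refine setIntegral_congr_fun measurableSet_Ioi fun r hr => ?_
  have hr' : (0 : ℝ) < r := hr
  simp only [smul_eq_mul]
  rw [Complex.ofReal_mul, Complex.ofReal_cpow hr'.le]
  push_cast
  rfl

/-- The Mellin transform of the Mainardi function on the right half-plane. -/
theorem mellin_mainardi {α : ℝ} (hα : α ∈ Set.Ioo (0 : ℝ) 1) {s : ℂ} (hs : 0 < s.re) :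
    mellin (fun r : ℝ => (mainardi α r : ℂ)) s =
      Complex.Gamma s * (Complex.Gamma (α * (s - 1) + 1))⁻¹ := by
  have hopen : IsOpen {z : ℂ | 0 < z.re} := isOpen_lt continuous_const Complex.continuous_re
  refine AnalyticOnNhd.eqOn_of_preconnected_of_frequently_eq (z₀ := ((1 / 2 : ℝ) : ℂ))
    ((differentiableOn_mellin_mainardi hα).analyticOnNhd hopen)
    (g := fun s : ℂ => Complex.Gamma s * (Complex.Gamma (α * (s - 1) + 1))⁻¹)
    (DifferentiableOn.analyticOnNhd ?_ hopen)
    (convex_halfSpace_re_gt 0).isPreconnected ?_ ?_ hs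
  · intro w hw
    have hw' : 0 < w.re := hw
    refine DifferentiableAt.differentiableWithinAt (DifferentiableAt.mul ?_ ?_)
    · refine Complex.differentiableAt_Gamma _ fun m hm => ?_
      rw [hm] at hw'
      simp only [Complex.neg_re, Complex.natCast_re] at hw'
      linarith [(m.cast_nonneg : (0 : ℝ) ≤ m)]
    · exact (Complex.differentiable_one_div_Gamma _).comp w (f := fun s : ℂ => α * (s - 1) + 1)
        (by fun_prop)
  · simp only [Set.mem_ofPred_eq, Complex.ofReal_re]
    norm_num
  · have ht : Filter.Tendsto (fun b : ℝ => (b : ℂ)) (nhdsWithin (1 / 2) (Set.Ioi (1 / 2)))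
        (nhdsWithin ((1 / 2 : ℝ) : ℂ) {((1 / 2 : ℝ) : ℂ)}ᶜ) := by
      refine tendsto_nhdsWithin_iff.2 ⟨?_, ?_⟩
      · exact (Complex.continuous_ofReal.tendsto _).mono_left nhdsWithin_le_nhds
      · filter_upwards [self_mem_nhdsWithin] with b hb
        simpa only [Set.mem_compl_iff, Set.mem_singleton_iff, Complex.ofReal_inj] using
          (ne_of_gt hb : b ≠ 1 / 2)
    refine ht.frequently (Filter.Eventually.frequently ?_)
    filter_upwards [Ioo_mem_nhdsGT (show (1 / 2 : ℝ) < 1 by norm_num)] with b hb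
    rw [mellin_mainardi_ofReal, integral_rpow_mul_mainardi_of_mem_Ioo hα
      ⟨by linarith [hb.1], hb.2⟩, Complex.ofReal_div, ← Complex.Gamma_ofReal,
      ← Complex.Gamma_ofReal, div_eq_mul_inv]
    push_cast
    rfl

theorem mainardi_moment (α δ : ℝ) (hα : α ∈ Set.Ioo (0 : ℝ) 1) (hδ : -1 < δ) :
    ∫ r in Set.Ioi (0 : ℝ), r ^ δ * mainardi α r =
      Real.Gamma (δ + 1) / Real.Gamma (α * δ + 1) := by
  have h := mellin_mainardi hα (s := ((δ + 1 : ℝ) : ℂ)) (by rw [Complex.ofReal_re]; linarith)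
  rw [mellin_mainardi_ofReal, add_sub_cancel_right, show (α : ℂ) * (((δ + 1 : ℝ) : ℂ) - 1) + 1 =
    ((α * δ + 1 : ℝ) : ℂ) by push_cast; ring, Complex.Gamma_ofReal, Complex.Gamma_ofReal] at h
  rw [div_eq_mul_inv]
  exact_mod_cast h
end

section
/- For 0 < α < 1 and λ ≥ 0, the Laplace transform of the Mainardi function satisfies ∫₀^∞ e^{-rλ} M_α(r) dr = E_α(-λ), where E_α(z) = Σ_{n=0}^∞ z^n / Γ(αn + 1) is the Mittag-Leffler function. -/
open Real MeasureTheory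

open Set Filter Asymptotics Topology

/-- The point at distance `u` from `c` on the ray of direction `exp (φ * I)` issued from `c`. -/
noncomputable def rayPoint (φ c u : ℝ) : ℂ := c + u * Complex.exp (φ * Complex.I)

lemma isBigO_exp_neg_of_le_add {a c p r β : ℝ} {X : ℝ → ℝ} (ha : 0 < a) (hβ : β < 1)
    (hX : Tendsto X atTop atTop) (hle : ∀ᶠ u in atTop, X u ≤ c + u) :
    (fun u ↦ exp (-a * u) * X u ^ p * exp (r * X u ^ β)) =O[atTop]
      fun u ↦ exp (-(a / 2) * u) := by
  have h1 : ∀ᶠ x : ℝ in atTop, x ^ p ≤ exp (a / 4 * x) := by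
    have := (isLittleO_rpow_exp_pos_mul_atTop p (b := a / 4) (by positivity)).bound one_pos
    filter_upwards [this] with x hx
    simpa [abs_of_pos (exp_pos _)] using (le_abs_self _).trans hx
  have h2 : ∀ᶠ x : ℝ in atTop, r * x ^ β ≤ a / 4 * x := by
    have ht : Tendsto (fun x : ℝ ↦ r * x ^ (-(1 - β))) atTop (𝓝 (r * 0)) :=
      (tendsto_rpow_neg_atTop (by linarith)).const_mul r
    rw [mul_zero] at ht
    filter_upwards [ht.eventually_lt_const (show 0 < a / 4 by positivity),
      eventually_gt_atTop 0] with x hx hx0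
    have : x ^ β = x ^ (-(1 - β)) * x := by
      nth_rewrite 3 [← rpow_one x]
      rw [← rpow_add hx0]; congr 1; ring
    rw [this, ← mul_assoc]
    exact mul_le_mul_of_nonneg_right hx.le hx0.le
  refine IsBigO.of_bound (exp (a / 2 * c)) ?_
  filter_upwards [hX.eventually h1, hX.eventually h2, hX.eventually_gt_atTop 0, hle]
    with u k1 k2 k3 k4
  have hp : 0 ≤ X u ^ p := rpow_nonneg k3.le p
  rw [norm_of_nonneg (by positivity), norm_of_nonneg (by positivity)]
  calc exp (-a * u) * X u ^ p * exp (r * X u ^ β)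
      ≤ exp (-a * u) * exp (a / 4 * X u) * exp (a / 4 * X u) := by gcongr
    _ = exp (-a * u + a / 2 * X u) := by rw [← exp_add, ← exp_add]; congr 1; ring
    _ ≤ exp (-a * u + a / 2 * (c + u)) := by gcongr
    _ = exp (a / 2 * c) * exp (-(a / 2) * u) := by rw [← exp_add]; congr 1; ring

lemma integrableOn_exp_neg_mul_rpow {a c p r β : ℝ} {X : ℝ → ℝ} (ha : 0 < a) (hβ : β < 1)
    (hX : Tendsto X atTop atTop) (hle : ∀ᶠ u in atTop, X u ≤ c + u)
    (hcont : Continuous X) (hpos : ∀ u ∈ Ici (0 : ℝ), 0 < X u) :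
    IntegrableOn (fun u ↦ exp (-a * u) * X u ^ p * exp (r * X u ^ β)) (Ioi 0) := by
  refine integrable_of_isBigO_exp_neg (b := a / 2) (by positivity) ?_
    (isBigO_exp_neg_of_le_add ha hβ hX hle)
  have h : ∀ q : ℝ, ContinuousOn (fun u ↦ X u ^ q) (Ici 0) := fun q ↦
    hcont.continuousOn.rpow_const fun u hu ↦ Or.inl (hpos u hu).ne'
  have := h p
  have := h β
  fun_prop

lemma integrableOn_exp_neg_mul_add_rpow {a c : ℝ} (p : ℝ) (ha : 0 < a) (hc : 0 < c) :
    IntegrableOn (fun u ↦ exp (-a * u) * (c + u) ^ p) (Ioi 0) := by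
  have := integrableOn_exp_neg_mul_rpow (c := c) (p := p) (r := 0) (β := 0) (X := fun u ↦ c + u) ha
    one_pos (tendsto_atTop_add_const_left _ _ tendsto_id) (Eventually.of_forall fun u ↦ le_rfl)
    (by fun_prop) (fun u hu ↦ by have : 0 ≤ u := hu; positivity)
  simpa using this

lemma tendsto_exp_neg_mul_add_rpow {a c : ℝ} (p : ℝ) (ha : 0 < a) :
    Tendsto (fun u ↦ exp (-a * u) * (c + u) ^ p) atTop (𝓝 0) := by
  have h := isBigO_exp_neg_of_le_add (c := c) (p := p) (r := 0) (β := 0) (X := fun u ↦ c + u) ha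
    one_pos (tendsto_atTop_add_const_left _ _ tendsto_id) (Eventually.of_forall fun u ↦ le_rfl)
  have h0 : Tendsto (fun u ↦ exp (-(a / 2) * u)) atTop (𝓝 0) :=
    tendsto_exp_atBot.comp (tendsto_id.const_mul_atTop_of_neg (by linarith))
  simpa using h.trans_tendsto h0

lemma integral_sub_integral_of_hasDerivAt {F G : ℝ → ℝ → ℂ} {B : ℝ → ℝ} {a b : ℝ} (hab : a ≤ b)
    (hF : ∀ u ∈ Ioi (0 : ℝ), ∀ t ∈ Icc a b, HasDerivAt (fun t ↦ F t u) (G t u) t)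
    (hG : Measurable (Function.uncurry G))
    (hB : ∀ t ∈ Ioc a b, ∀ u ∈ Ioi (0 : ℝ), ‖G t u‖ ≤ B u) (hBi : IntegrableOn B (Ioi 0))
    (ha : IntegrableOn (F a) (Ioi 0)) (hb : IntegrableOn (F b) (Ioi 0)) :
    (∫ u in Ioi 0, F b u) - ∫ u in Ioi 0, F a u = ∫ t in a..b, ∫ u in Ioi 0, G t u := by
  rw [← integral_sub hb ha, intervalIntegral_integral_swap]
  · refine setIntegral_congr_fun measurableSet_Ioi fun u hu ↦ ?_
    refine (intervalIntegral.integral_eq_sub_of_hasDerivAt (f := fun t ↦ F t u) ?_ ?_).symm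
    · rw [uIcc_of_le hab]; exact hF u hu
    · rw [intervalIntegrable_iff_integrableOn_Ioc_of_le hab]
      refine Measure.integrableOn_of_bounded (M := B u) (by simp)
        (hG.comp (measurable_id.prodMk measurable_const)).aestronglyMeasurable ?_
      exact (ae_restrict_iff' measurableSet_Ioc).2 (Eventually.of_forall fun t ht ↦ hB t ht u hu)
  · rw [uIoc_of_le hab]
    have h1 : Integrable (fun z : ℝ × ℝ ↦ (1 : ℝ) * B z.2)
        ((volume.restrict (Ioc a b)).prod (volume.restrict (Ioi 0))) :=
      (integrable_const (1 : ℝ)).mul_prod hBi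
    refine h1.mono' hG.aestronglyMeasurable ?_
    rw [Measure.prod_restrict, ae_restrict_iff' (measurableSet_Ioc.prod measurableSet_Ioi)]
    refine Eventually.of_forall fun z hz ↦ ?_
    rw [one_mul]
    exact hB z.1 hz.1 z.2 hz.2

lemma norm_exp_mul_exp_mul_I (θ u : ℝ) :
    ‖Complex.exp (u * Complex.exp (θ * Complex.I))‖ = exp (cos θ * u) := by
  rw [Complex.norm_exp, Complex.re_ofReal_mul, Complex.exp_ofReal_mul_I_re, mul_comm]

lemma integrableOn_exp_mul_rpow_ray {φ p : ℝ} (θ : ℝ) (h1 : π / 2 < φ) (hθ : θ ∈ Icc φ π)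
    (hp : 0 < p) (q : ℂ) :
    IntegrableOn (fun u : ℝ ↦ Complex.exp (u * Complex.exp (θ * Complex.I)) * ((u ^ p : ℝ) : ℂ) * q)
      (Ioi 0) := by
  have hcos : cos φ < 0 := cos_neg_of_pi_div_two_lt_of_lt h1 (by linarith [hθ.1, hθ.2, pi_pos])
  have hcos' : cos θ ≤ cos φ := cos_le_cos_of_nonneg_of_le_pi (by linarith [pi_pos]) hθ.2 hθ.1
  refine Integrable.mul_const ?_ q
  refine (integrableOn_exp_neg_mul_add_rpow p (neg_pos.2 hcos) one_pos).mono' ?_ ?_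
  · exact (by fun_prop : Measurable _).aestronglyMeasurable
  · refine (ae_restrict_iff' measurableSet_Ioi).2 (Eventually.of_forall fun u hu ↦ ?_)
    have hu : 0 < u := hu
    rw [norm_mul, norm_exp_mul_exp_mul_I, Complex.norm_real, norm_of_nonneg (by positivity),
      neg_neg]
    gcongr
    linarith

/-- Rotating the ray of integration in Euler's integral. -/
lemma integral_exp_mul_rpow_ray {φ p : ℝ} (h1 : π / 2 < φ) (h2 : φ < π) (hp : 0 < p) :
    ∫ u in Ioi (0 : ℝ), Complex.exp (u * Complex.exp (φ * Complex.I)) * ((u ^ p : ℝ) : ℂ) *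
      Complex.exp (φ * Complex.I * (p + 1)) =
    Complex.exp (π * Complex.I * (p + 1)) * Gamma (p + 1) := by
  have hcos : cos φ < 0 := cos_neg_of_pi_div_two_lt_of_lt h1 (by linarith)
  have hcos' : ∀ θ ∈ Icc φ π, cos θ ≤ cos φ := fun θ hθ ↦
    cos_le_cos_of_nonneg_of_le_pi (by linarith [pi_pos]) hθ.2 hθ.1
  set g : ℝ → ℝ → ℂ := fun θ u ↦ Complex.exp (u * Complex.exp (θ * Complex.I)) *
    ((u ^ p : ℝ) : ℂ) * Complex.exp (θ * Complex.I * (p + 1)) with hg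
  set G : ℝ → ℝ → ℂ := fun θ u ↦
    Complex.I * (u * Complex.exp (θ * Complex.I) + (p + 1)) * g θ u with hG
  have hgnorm : ∀ θ ∈ Icc φ π, ∀ u ∈ Ioi (0 : ℝ), ‖g θ u‖ ≤ exp (-(-cos φ) * u) * (1 + u) ^ p := by
    intro θ hθ u hu
    have hu : 0 < u := hu
    have : ‖Complex.exp (θ * Complex.I * (p + 1))‖ = 1 := by
      rw [show (θ * Complex.I * (p + 1) : ℂ) = ((θ * (p + 1) : ℝ) : ℂ) * Complex.I by
        push_cast; ring, Complex.norm_exp_ofReal_mul_I]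
    simp only [hg]
    rw [norm_mul, norm_mul, this, norm_exp_mul_exp_mul_I, Complex.norm_real,
      norm_of_nonneg (by positivity), neg_neg, mul_one]
    have := hcos' θ hθ
    gcongr
    linarith
  have hGnorm : ∀ θ ∈ Icc φ π, ∀ u ∈ Ioi (0 : ℝ), ‖G θ u‖ ≤
      exp (-(-cos φ) * u) * (1 + u) ^ (p + 1) + (p + 1) * (exp (-(-cos φ) * u) * (1 + u) ^ p) := by
    intro θ hθ u hu
    have h := hgnorm θ hθ u hu
    have hu : 0 < u := hu
    simp only [hG]
    have hk : ‖(u * Complex.exp (θ * Complex.I) + (p + 1) : ℂ)‖ ≤ (1 + u) + (p + 1) := by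
      refine (norm_add_le _ _).trans ?_
      rw [norm_mul, Complex.norm_exp_ofReal_mul_I, Complex.norm_real, norm_of_nonneg hu.le,
        show (p + 1 : ℂ) = ((p + 1 : ℝ) : ℂ) by push_cast; ring, Complex.norm_real,
        norm_of_nonneg (by positivity)]
      linarith
    rw [norm_mul, norm_mul, Complex.norm_I, one_mul]
    calc _ ≤ ((1 + u) + (p + 1)) * (exp (-(-cos φ) * u) * (1 + u) ^ p) := by gcongr
      _ = _ := by rw [rpow_add_one (by positivity)]; ring
  have hB : IntegrableOn (fun u ↦ exp (-(-cos φ) * u) * (1 + u) ^ (p + 1) +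
      (p + 1) * (exp (-(-cos φ) * u) * (1 + u) ^ p)) (Ioi 0) :=
    (integrableOn_exp_neg_mul_add_rpow _ (neg_pos.2 hcos) one_pos).add
      ((integrableOn_exp_neg_mul_add_rpow _ (neg_pos.2 hcos) one_pos).const_mul _)
  have hGm : Measurable (Function.uncurry G) := by
    simp only [hG, hg, Function.uncurry_def]
    fun_prop
  have hinner : ∀ θ ∈ Icc φ π, ∫ u in Ioi (0 : ℝ), G θ u = 0 := by
    intro θ hθ
    have hd : ∀ u ∈ Ioi (0 : ℝ), HasDerivAt (fun u : ℝ ↦ Complex.I * (u * g θ u)) (G θ u) u := by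
      intro u hu
      have hu0 : u ≠ 0 := (ne_of_gt hu)
      have e1 : HasDerivAt (fun u : ℝ ↦ ((u ^ p : ℝ) : ℂ)) ((p * u ^ (p - 1) : ℝ) : ℂ) u :=
        (hasDerivAt_rpow_const (Or.inl hu0)).ofReal_comp
      have e0 : HasDerivAt (fun u : ℝ ↦ (u : ℂ)) 1 u := (hasDerivAt_id u).ofReal_comp
      have e2 := (e0.mul_const (Complex.exp (θ * Complex.I))).cexp
      have e3 := (e0.mul ((e2.mul e1).mul_const
        (Complex.exp (θ * Complex.I * (p + 1))))).const_mul Complex.I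
      refine e3.congr_deriv ?_
      have : ((u ^ p : ℝ) : ℂ) = u * ((u ^ (p - 1) : ℝ) : ℂ) := by
        rw [← Complex.ofReal_mul, rpow_sub_one hu0]; congr 1; field_simp
      simp only [hG, hg, Complex.ofReal_mul, this, Pi.mul_apply]
      ring
    have := integral_Ioi_of_hasDerivAt_of_tendsto (m := 0) (a := 0) ?_ hd ?_ ?_
    · simpa using this
    · have : Continuous (fun u : ℝ ↦ Complex.I * (u * g θ u)) := by
        have : Continuous fun u : ℝ ↦ u ^ p := continuous_id.rpow_const fun _ ↦ Or.inr hp.le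
        simp only [hg]
        fun_prop
      exact this.continuousWithinAt
    · refine hB.mono' (hGm.comp (measurable_const.prodMk measurable_id)).aestronglyMeasurable ?_
      exact (ae_restrict_iff' measurableSet_Ioi).2 (Eventually.of_forall fun u hu ↦ hGnorm θ hθ u hu)
    · refine squeeze_zero_norm' ?_
        (tendsto_exp_neg_mul_add_rpow (c := 1) (p + 1) (neg_pos.2 hcos))
      filter_upwards [eventually_gt_atTop 0] with u hu
      have := hgnorm θ hθ u hu
      rw [norm_mul, norm_mul, Complex.norm_I, one_mul, Complex.norm_real, norm_of_nonneg hu.le]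
      calc u * ‖g θ u‖ ≤ (1 + u) * (exp (-(-cos φ) * u) * (1 + u) ^ p) := by
            gcongr; linarith
        _ = _ := by rw [rpow_add_one (by positivity)]; ring
  have key := integral_sub_integral_of_hasDerivAt (F := g) (G := G) h2.le ?_ hGm
    (fun t ht ↦ hGnorm t (Ioc_subset_Icc_self ht)) hB
    (integrableOn_exp_mul_rpow_ray φ h1 ⟨le_rfl, h2.le⟩ hp _)
    (integrableOn_exp_mul_rpow_ray π h1 ⟨h2.le, le_rfl⟩ hp _)
  · rw [intervalIntegral.integral_congr (g := fun _ ↦ 0)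
      (fun t ht ↦ hinner t (by rwa [uIcc_of_le h2.le] at ht)), intervalIntegral.integral_zero,
      sub_eq_zero] at key
    rw [← key, Gamma_eq_integral (by positivity), ← integral_complex_ofReal, ← integral_const_mul]
    refine setIntegral_congr_fun measurableSet_Ioi fun u hu ↦ ?_
    simp only [hg, Complex.exp_pi_mul_I]
    push_cast
    simp only [add_sub_cancel_right]
    ring_nf
  · intro u hu θ hθ
    have e0 : HasDerivAt (fun u : ℝ ↦ (u : ℂ)) 1 θ := (hasDerivAt_id θ).ofReal_comp
    have e1 := (((e0.mul_const Complex.I).cexp.const_mul (u : ℂ)).cexp.mul_const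
      ((u ^ p : ℝ) : ℂ)).mul ((e0.mul_const Complex.I).mul_const (p + 1 : ℂ)).cexp
    refine e1.congr_deriv ?_
    simp only [hG, hg]
    ring

section rayPoint

variable {φ c u : ℝ}

lemma rayPoint_re (φ c u : ℝ) : (rayPoint φ c u).re = c + u * cos φ := by
  simp [rayPoint, Complex.exp_ofReal_mul_I_re]

lemma rayPoint_im (φ c u : ℝ) : (rayPoint φ c u).im = u * sin φ := by
  simp [rayPoint, Complex.exp_ofReal_mul_I_im]

lemma measurable_rayPoint (φ : ℝ) : Measurable fun z : ℝ × ℝ ↦ rayPoint φ z.1 z.2 := by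
  unfold rayPoint
  fun_prop

lemma measurable_rayPoint_right (φ c : ℝ) : Measurable (rayPoint φ c) := by
  unfold rayPoint
  fun_prop

lemma continuous_rayPoint_right (φ c : ℝ) : Continuous (rayPoint φ c) := by
  unfold rayPoint
  fun_prop

lemma norm_rayPoint_le (hc : 0 ≤ c) (hu : 0 ≤ u) : ‖rayPoint φ c u‖ ≤ c + u := by
  refine (norm_add_le _ _).trans ?_
  rw [norm_mul, Complex.norm_exp_ofReal_mul_I, Complex.norm_real, Complex.norm_real,
    norm_of_nonneg hc, norm_of_nonneg hu, mul_one]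

lemma sin_mul_le_norm_rayPoint : sin φ * u ≤ ‖rayPoint φ c u‖ := by
  have := Complex.im_le_norm (rayPoint φ c u)
  rw [rayPoint_im] at this
  linarith

lemma mul_sin_le_norm_rayPoint : c * sin φ ≤ ‖rayPoint φ c u‖ := by
  refine le_of_sq_le_sq ?_ (norm_nonneg _)
  rw [Complex.sq_norm, Complex.normSq_apply, rayPoint_re, rayPoint_im]
  have : (c + u * cos φ) * (c + u * cos φ) + u * sin φ * (u * sin φ) =
      (c * sin φ) ^ 2 + (u + c * cos φ) ^ 2 := by
    linear_combination (u ^ 2 - c ^ 2) * sin_sq_add_cos_sq φ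
  rw [this]
  exact le_add_of_nonneg_right (sq_nonneg _)

lemma rayPoint_mem_slitPlane (hφ : 0 < sin φ) (hc : 0 < c) (hu : 0 ≤ u) :
    rayPoint φ c u ∈ Complex.slitPlane := by
  rw [Complex.mem_slitPlane_iff, rayPoint_re, rayPoint_im]
  rcases hu.eq_or_lt with rfl | hu
  · left; simpa using hc
  · right; positivity

lemma norm_rayPoint_pos (hφ : 0 < sin φ) (hc : 0 < c) : 0 < ‖rayPoint φ c u‖ :=
  (mul_pos hc hφ).trans_le mul_sin_le_norm_rayPoint

lemma arg_rayPoint_mem (h0 : 0 < φ) (h1 : φ < π) (hc : 0 < c) (hu : 0 ≤ u) :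
    (rayPoint φ c u).arg ∈ Icc 0 φ := by
  have hs : 0 < sin φ := sin_pos_of_pos_of_lt_pi h0 h1
  have hnn : 0 ≤ (rayPoint φ c u).arg := by
    rw [Complex.arg_nonneg_iff, rayPoint_im]; positivity
  refine ⟨hnn, ?_⟩
  by_contra! hlt
  have hpos : 0 < sin ((rayPoint φ c u).arg - φ) :=
    sin_pos_of_pos_of_lt_pi (by linarith) (by linarith [Complex.arg_le_pi (rayPoint φ c u)])
  have hre := Complex.norm_mul_cos_arg (rayPoint φ c u)
  have him := Complex.norm_mul_sin_arg (rayPoint φ c u)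
  rw [rayPoint_re] at hre
  rw [rayPoint_im] at him
  have hmul := mul_pos (norm_rayPoint_pos (u := u) hs hc) hpos
  rw [sin_sub, mul_sub, ← mul_assoc, ← mul_assoc, him, hre] at hmul
  nlinarith [mul_pos hc hs]

lemma le_re_rayPoint_cpow {α : ℝ} (hα : 0 < α) (h0 : 0 < φ) (h1 : φ < π) (hαφ : α * φ < π / 2)
    (hc : 0 < c) (hu : 0 ≤ u) :
    (c * sin φ) ^ α * cos (α * φ) ≤ (rayPoint φ c u ^ (α : ℂ)).re := by
  have hs : 0 < sin φ := sin_pos_of_pos_of_lt_pi h0 h1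
  obtain ⟨ha0, ha1⟩ := arg_rayPoint_mem h0 h1 hc hu
  rw [Complex.cpow_ofReal, Complex.re_ofReal_mul]
  simp only [Complex.add_re, Complex.ofReal_re, Complex.mul_re, Complex.I_re, mul_zero,
    Complex.ofReal_im, Complex.I_im, zero_mul, sub_zero, add_zero]
  have hcos : cos (α * φ) ≤ cos ((rayPoint φ c u).arg * α) := by
    refine cos_le_cos_of_nonneg_of_le_pi (by positivity) (by linarith [pi_pos]) ?_
    rw [mul_comm]; gcongr
  have hcos0 : 0 ≤ cos (α * φ) := cos_nonneg_of_mem_Icc ⟨by nlinarith [pi_pos], hαφ.le⟩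
  gcongr
  exact mul_sin_le_norm_rayPoint

lemma norm_exp_rayPoint (φ c u : ℝ) :
    ‖Complex.exp (rayPoint φ c u)‖ = exp c * exp (-(-cos φ) * u) := by
  rw [Complex.norm_exp, rayPoint_re, ← exp_add]
  congr 1; ring

lemma tendsto_norm_rayPoint (hφ : 0 < sin φ) :
    Tendsto (fun u ↦ ‖rayPoint φ c u‖) atTop atTop :=
  tendsto_atTop_mono (fun _ ↦ sin_mul_le_norm_rayPoint) (tendsto_id.const_mul_atTop hφ)

lemma integrableOn_norm_exp_rayPoint {p r β : ℝ} (hcos : cos φ < 0) (hφ : 0 < sin φ) (hβ : β < 1)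
    (hc : 0 < c) :
    IntegrableOn (fun u ↦ ‖Complex.exp (rayPoint φ c u)‖ * ‖rayPoint φ c u‖ ^ p *
      exp (r * ‖rayPoint φ c u‖ ^ β)) (Ioi 0) := by
  have := integrableOn_exp_neg_mul_rpow (c := c) (p := p) (r := r) (neg_pos.2 hcos) hβ
    (tendsto_norm_rayPoint (c := c) hφ)
    ((eventually_ge_atTop 0).mono fun u hu ↦ norm_rayPoint_le hc.le hu)
    (continuous_rayPoint_right φ c).norm (fun u _ ↦ norm_rayPoint_pos hφ hc)
  refine (this.const_mul (exp c)).congr (Eventually.of_forall fun u ↦ ?_)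
  simp only [norm_exp_rayPoint]
  ring

lemma integrableOn_norm_exp_rayPoint_mul_rpow (p : ℝ) (hcos : cos φ < 0) (hφ : 0 < sin φ)
    (hc : 0 < c) :
    IntegrableOn (fun u ↦ ‖Complex.exp (rayPoint φ c u)‖ * ‖rayPoint φ c u‖ ^ p) (Ioi 0) := by
  simpa using integrableOn_norm_exp_rayPoint (p := p) (r := 0) (β := 0) hcos hφ one_pos hc

lemma measurable_exp_rayPoint_mul_cpow (φ c : ℝ) (p : ℂ) :
    Measurable fun u ↦ Complex.exp (rayPoint φ c u) * rayPoint φ c u ^ p := by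
  have := measurable_rayPoint_right φ c
  fun_prop

lemma integrableOn_exp_rayPoint_mul_cpow (p : ℝ) (hcos : cos φ < 0) (hφ : 0 < sin φ)
    (hc : 0 < c) :
    IntegrableOn (fun u ↦ Complex.exp (rayPoint φ c u) * rayPoint φ c u ^ (p : ℂ)) (Ioi 0) := by
  refine (integrableOn_norm_exp_rayPoint_mul_rpow p hcos hφ hc).mono'
    (measurable_exp_rayPoint_mul_cpow φ c p).aestronglyMeasurable
    (Eventually.of_forall fun u ↦ ?_)
  rw [norm_mul, Complex.norm_cpow_real]

end rayPoint

lemma hasDerivAt_exp_mul_cpow {s : ℂ} (hs : s ∈ Complex.slitPlane) (p : ℝ) :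
    HasDerivAt (fun s : ℂ ↦ Complex.exp s * s ^ (p : ℂ))
      (Complex.exp s * s ^ (p : ℂ) + p * (Complex.exp s * s ^ ((p - 1 : ℝ) : ℂ))) s := by
  have := (Complex.hasDerivAt_exp s).mul ((hasDerivAt_id s).cpow_const (c := (p : ℂ)) hs)
  refine this.congr_deriv ?_
  push_cast
  simp only [id]
  ring

/-- The derivative of `exp s * s ^ p` integrates to minus the initial value along the ray. -/
lemma integral_deriv_exp_mul_cpow_rayPoint {φ c : ℝ} (p : ℝ) (hcos : cos φ < 0) (hφ : 0 < sin φ)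
    (hc : 0 < c) :
    ∫ u in Ioi (0 : ℝ), (Complex.exp (rayPoint φ c u) * rayPoint φ c u ^ (p : ℂ) +
      p * (Complex.exp (rayPoint φ c u) * rayPoint φ c u ^ ((p - 1 : ℝ) : ℂ))) *
        Complex.exp (φ * Complex.I) = -((exp c * c ^ p : ℝ) : ℂ) := by
  have hd : ∀ u ∈ Ici (0 : ℝ), HasDerivAt
      (fun u : ℝ ↦ Complex.exp (rayPoint φ c u) * rayPoint φ c u ^ (p : ℂ))
      ((Complex.exp (rayPoint φ c u) * rayPoint φ c u ^ (p : ℂ) +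
      p * (Complex.exp (rayPoint φ c u) * rayPoint φ c u ^ ((p - 1 : ℝ) : ℂ))) *
        Complex.exp (φ * Complex.I)) u := by
    intro u hu
    have e0 : HasDerivAt (fun u : ℝ ↦ (u : ℂ)) 1 u := (hasDerivAt_id u).ofReal_comp
    have e1 : HasDerivAt (rayPoint φ c) (Complex.exp (φ * Complex.I)) u := by
      have := (e0.mul_const (Complex.exp (φ * Complex.I))).const_add (c : ℂ)
      rwa [one_mul] at this
    exact (hasDerivAt_exp_mul_cpow (rayPoint_mem_slitPlane hφ hc hu) p).comp u e1
  have := integral_Ioi_of_hasDerivAt_of_tendsto (m := 0) (a := 0)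
    (hd 0 self_mem_Ici).continuousAt.continuousWithinAt
    (fun u hu ↦ hd u (Ioi_subset_Ici_self hu)) ?_ ?_
  · rw [this]
    simp only [rayPoint, Complex.ofReal_zero, zero_mul, add_zero, zero_sub]
    push_cast
    rw [Complex.ofReal_cpow hc.le]
  · exact ((integrableOn_exp_rayPoint_mul_cpow p hcos hφ hc).add
      ((integrableOn_exp_rayPoint_mul_cpow (p - 1) hcos hφ hc).const_mul _)).mul_const _
  · have h := isBigO_exp_neg_of_le_add (p := p) (r := 0) (β := 0) (neg_pos.2 hcos) one_pos
      (tendsto_norm_rayPoint (c := c) hφ)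
      ((eventually_ge_atTop 0).mono fun u hu ↦ norm_rayPoint_le hc.le hu)
    have h0 : Tendsto (fun u ↦ exp (-(-cos φ / 2) * u)) atTop (𝓝 0) :=
      tendsto_exp_atBot.comp (tendsto_id.const_mul_atTop_of_neg (by linarith))
    have hlim := (h.trans_tendsto h0).const_mul (exp c)
    rw [mul_zero] at hlim
    refine squeeze_zero_norm (fun u ↦ le_of_eq ?_) hlim
    rw [norm_mul, norm_exp_rayPoint, Complex.norm_cpow_real]
    simp [mul_assoc]

lemma im_integral_exp_mul_cpow_rayPoint_add {φ c : ℝ} (p : ℝ) (hcos : cos φ < 0)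
    (hφ : 0 < sin φ) (hc : 0 < c) :
    (∫ u in Ioi (0 : ℝ), Complex.exp (rayPoint φ c u) * rayPoint φ c u ^ (p : ℂ) *
        Complex.exp (φ * Complex.I)).im +
      p * (∫ u in Ioi (0 : ℝ), Complex.exp (rayPoint φ c u) * rayPoint φ c u ^ ((p - 1 : ℝ) : ℂ) *
        Complex.exp (φ * Complex.I)).im = 0 := by
  have h := congrArg Complex.im (integral_deriv_exp_mul_cpow_rayPoint p hcos hφ hc)
  simp only [add_mul, mul_assoc (p : ℂ)] at h
  rw [integral_add ((integrableOn_exp_rayPoint_mul_cpow p hcos hφ hc).mul_const _)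
    (((integrableOn_exp_rayPoint_mul_cpow (p - 1) hcos hφ hc).mul_const _).const_mul _),
    integral_const_mul, Complex.add_im, Complex.im_ofReal_mul, Complex.neg_im,
    Complex.ofReal_im, neg_zero] at h
  exact h

lemma rayPoint_zero_cpow_mul {φ u : ℝ} (h0 : 0 < φ) (h1 : φ < π) (hu : 0 < u) (p : ℝ) :
    rayPoint φ 0 u ^ (p : ℂ) * Complex.exp (φ * Complex.I) =
      ((u ^ p : ℝ) : ℂ) * Complex.exp (φ * Complex.I * (p + 1)) := by
  have harg : (rayPoint φ 0 u).arg = φ := by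
    rw [rayPoint, Complex.exp_mul_I, Complex.ofReal_zero, zero_add]
    exact Complex.arg_mul_cos_add_sin_mul_I hu ⟨by linarith, h1.le⟩
  have hnorm : ‖rayPoint φ 0 u‖ = u := by
    simp [rayPoint, Complex.norm_exp_ofReal_mul_I, abs_of_pos hu]
  rw [Complex.cpow_ofReal, harg, hnorm, Complex.ofReal_cos, Complex.ofReal_sin,
    ← Complex.exp_mul_I, mul_assoc, ← Complex.exp_add]
  congr 2
  push_cast; ring

/-- Translating the ray along the real axis does not change the imaginary part. -/
lemma im_integral_exp_mul_cpow_rayPoint_of_one_lt {φ c p : ℝ} (h1 : π / 2 < φ) (h2 : φ < π)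
    (hc : 0 < c) (hp : 1 < p) :
    (∫ u in Ioi (0 : ℝ), Complex.exp (rayPoint φ c u) * rayPoint φ c u ^ (p : ℂ) *
        Complex.exp (φ * Complex.I)).im = π * (Gamma (-p))⁻¹ := by
  have hcos : cos φ < 0 := cos_neg_of_pi_div_two_lt_of_lt h1 (by linarith)
  have h0 : 0 < φ := by linarith [pi_pos]
  have hφ : 0 < sin φ := sin_pos_of_pos_of_lt_pi h0 h2
  have hzero : ∀ u ∈ Ioi (0 : ℝ), Complex.exp (u * Complex.exp (φ * Complex.I)) *
      ((u ^ p : ℝ) : ℂ) * Complex.exp (φ * Complex.I * (p + 1)) =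
      Complex.exp (rayPoint φ 0 u) * rayPoint φ 0 u ^ (p : ℂ) * Complex.exp (φ * Complex.I) := by
    intro u hu
    rw [mul_assoc, ← rayPoint_zero_cpow_mul h0 h2 hu, ← mul_assoc]
    simp [rayPoint]
  have key := integral_sub_integral_of_hasDerivAt
    (F := fun t u ↦ Complex.exp (rayPoint φ t u) * rayPoint φ t u ^ (p : ℂ) *
      Complex.exp (φ * Complex.I))
    (G := fun t u ↦ (Complex.exp (rayPoint φ t u) * rayPoint φ t u ^ (p : ℂ) +
      p * (Complex.exp (rayPoint φ t u) * rayPoint φ t u ^ ((p - 1 : ℝ) : ℂ))) *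
        Complex.exp (φ * Complex.I))
    (B := fun u ↦ exp c * (exp (-(-cos φ) * u) * (c + u) ^ p) +
      p * (exp c * (exp (-(-cos φ) * u) * (c + u) ^ (p - 1)))) hc.le ?_ ?_ ?_ ?_ ?_
      ((integrableOn_exp_rayPoint_mul_cpow p hcos hφ hc).mul_const _)
  · have hG : ∫ t in (0 : ℝ)..c, ∫ u in Ioi (0 : ℝ),
        (Complex.exp (rayPoint φ t u) * rayPoint φ t u ^ (p : ℂ) +
        p * (Complex.exp (rayPoint φ t u) * rayPoint φ t u ^ ((p - 1 : ℝ) : ℂ))) *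
          Complex.exp (φ * Complex.I) = ((∫ t in (0 : ℝ)..c, -(exp t * t ^ p) : ℝ) : ℂ) := by
      rw [← intervalIntegral.integral_ofReal]
      refine intervalIntegral.integral_congr_ae (Eventually.of_forall fun t ht ↦ ?_)
      rw [uIoc_of_le hc.le] at ht
      rw [integral_deriv_exp_mul_cpow_rayPoint p hcos hφ ht.1, Complex.ofReal_neg]
    rw [hG, ← setIntegral_congr_fun measurableSet_Ioi hzero,
      integral_exp_mul_rpow_ray h1 h2 (by linarith), sub_eq_iff_eq_add] at key
    rw [key, Complex.add_im, Complex.ofReal_im, zero_add, Complex.im_mul_ofReal,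
      show (π * Complex.I * (p + 1) : ℂ) = ((π * (p + 1) : ℝ) : ℂ) * Complex.I by push_cast; ring,
      Complex.exp_ofReal_mul_I_im]
    have hrefl := Gamma_mul_Gamma_one_sub (p + 1)
    have hpos : 0 < Gamma (p + 1) := Gamma_pos_of_pos (by linarith)
    rw [show 1 - (p + 1) = -p by ring] at hrefl
    have : Gamma (-p) = π / sin (π * (p + 1)) / Gamma (p + 1) := by
      rw [← hrefl]; field_simp
    rw [this, inv_div, div_div_eq_mul_div]
    have := pi_pos.ne'
    field_simp
  · intro u hu t ht
    have e0 : HasDerivAt (fun u : ℝ ↦ (u : ℂ)) 1 t := (hasDerivAt_id t).ofReal_comp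
    have e1 : HasDerivAt (fun t ↦ rayPoint φ t u) 1 t := e0.add_const _
    have hu : 0 < u := hu
    have hmem : rayPoint φ t u ∈ Complex.slitPlane := by
      rw [Complex.mem_slitPlane_iff, rayPoint_im]
      right; positivity
    simpa using ((hasDerivAt_exp_mul_cpow hmem p).comp t e1).mul_const (Complex.exp (φ * Complex.I))
  · have := measurable_rayPoint φ
    simp only [Function.uncurry_def]
    fun_prop
  · intro t ht u hu
    have hu : 0 < u := hu
    have hle : ‖rayPoint φ t u‖ ≤ c + u :=
      (norm_rayPoint_le ht.1.le hu.le).trans (by linarith [ht.2])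
    have hexp : exp t ≤ exp c := exp_le_exp.2 ht.2
    rw [norm_mul, Complex.norm_exp_ofReal_mul_I, mul_one]
    refine (norm_add_le _ _).trans ?_
    rw [norm_mul, norm_mul, norm_mul, Complex.norm_cpow_real, Complex.norm_cpow_real,
      norm_exp_rayPoint, Complex.norm_real, norm_of_nonneg (by linarith : 0 ≤ p), mul_assoc,
      mul_assoc]
    have : 0 ≤ p - 1 := by linarith
    gcongr
  · exact ((integrableOn_exp_neg_mul_add_rpow _ (neg_pos.2 hcos) hc).const_mul _).add
      (((integrableOn_exp_neg_mul_add_rpow _ (neg_pos.2 hcos) hc).const_mul _).const_mul _)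
  · exact (integrableOn_exp_mul_rpow_ray φ h1 ⟨le_rfl, h2.le⟩ (by linarith) _).congr_fun hzero
      measurableSet_Ioi

lemma im_integral_exp_mul_cpow_rayPoint_of_irrational {φ c : ℝ} (h1 : π / 2 < φ) (h2 : φ < π)
    (hc : 0 < c) {p : ℝ} (hp : Irrational p) :
    (∫ u in Ioi (0 : ℝ), Complex.exp (rayPoint φ c u) * rayPoint φ c u ^ (p : ℂ) *
        Complex.exp (φ * Complex.I)).im = π * (Gamma (-p))⁻¹ := by
  have hcos : cos φ < 0 := cos_neg_of_pi_div_two_lt_of_lt h1 (by linarith)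
  have hφ : 0 < sin φ := sin_pos_of_pos_of_lt_pi (by linarith [pi_pos]) h2
  obtain ⟨n, hn⟩ := exists_nat_gt (1 - p)
  induction n generalizing p with
  | zero =>
    exact im_integral_exp_mul_cpow_rayPoint_of_one_lt h1 h2 hc (by simp at hn; linarith)
  | succ n ih =>
    have hp1 : Irrational (p + 1) := by simpa using hp.add_natCast 1
    have hne : p + 1 ≠ 0 := by simpa using hp1.ne_nat 0
    have hI := ih hp1 (by push_cast at hn; linarith)
    have hrec := im_integral_exp_mul_cpow_rayPoint_add (p + 1) hcos hφ hc
    rw [hI, add_sub_cancel_right] at hrec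
    have hG : Gamma (-p) = -(p + 1) * Gamma (-(p + 1)) := by
      rw [← Gamma_add_one (neg_ne_zero.2 hne)]; congr 1; ring
    rw [mul_comm (p + 1)] at hrec
    rw [hG, mul_inv, inv_neg, eq_div_of_mul_eq hne (eq_neg_of_add_eq_zero_right hrec)]
    ring

lemma continuous_inv_Gamma : Continuous fun x : ℝ ↦ (Gamma x)⁻¹ := by
  have h := Complex.continuous_re.comp
    (Complex.differentiable_one_div_Gamma.continuous.comp Complex.continuous_ofReal)
  refine h.congr fun x ↦ ?_
  simp [Function.comp_apply, Complex.Gamma_ofReal, ← Complex.ofReal_inv]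

lemma continuous_integral_exp_mul_cpow_rayPoint {φ c : ℝ} (hcos : cos φ < 0) (hφ : 0 < sin φ)
    (hc : 0 < c) :
    Continuous fun p : ℝ ↦ ∫ u in Ioi (0 : ℝ), Complex.exp (rayPoint φ c u) *
      rayPoint φ c u ^ (p : ℂ) * Complex.exp (φ * Complex.I) := by
  refine continuous_iff_continuousAt.2 fun p ↦ ?_
  refine continuousAt_of_dominated (bound := fun u ↦
      ‖Complex.exp (rayPoint φ c u)‖ * ‖rayPoint φ c u‖ ^ (p - 1) +
      ‖Complex.exp (rayPoint φ c u)‖ * ‖rayPoint φ c u‖ ^ (p + 1)) ?_ ?_ ?_ ?_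
  · exact Eventually.of_forall fun q ↦
      ((measurable_exp_rayPoint_mul_cpow φ c q).mul_const _).aestronglyMeasurable
  · filter_upwards [Icc_mem_nhds (sub_one_lt p) (lt_add_one p)] with q hq
    refine Eventually.of_forall fun u ↦ ?_
    have hpos := norm_rayPoint_pos (u := u) hφ hc
    rw [norm_mul, norm_mul, Complex.norm_exp_ofReal_mul_I, Complex.norm_cpow_real, mul_one,
      ← mul_add]
    refine mul_le_mul_of_nonneg_left ?_ (norm_nonneg _)
    rcases le_total 1 ‖rayPoint φ c u‖ with h | h
    · exact (rpow_le_rpow_of_exponent_le h hq.2).trans (le_add_of_nonneg_left (by positivity))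
    · exact (rpow_le_rpow_of_exponent_ge hpos h hq.1).trans
        (le_add_of_nonneg_right (by positivity))
  · exact (integrableOn_norm_exp_rayPoint_mul_rpow _ hcos hφ hc).add
      (integrableOn_norm_exp_rayPoint_mul_rpow _ hcos hφ hc)
  · refine Eventually.of_forall fun u ↦ ?_
    have hne : rayPoint φ c u ≠ 0 := norm_pos_iff.1 (norm_rayPoint_pos hφ hc)
    have : Continuous fun q : ℝ ↦ rayPoint φ c u ^ (q : ℂ) :=
      Complex.continuous_ofReal.const_cpow (Or.inl hne)
    exact ((continuous_const.mul this).mul continuous_const).continuousAt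

/-- Hankel's formula for the reciprocal Gamma function, on the upper half of a wedge-shaped
contour. -/
theorem im_integral_exp_mul_cpow_rayPoint {φ c : ℝ} (h1 : π / 2 < φ) (h2 : φ < π)
    (hc : 0 < c) (p : ℝ) :
    (∫ u in Ioi (0 : ℝ), Complex.exp (rayPoint φ c u) * rayPoint φ c u ^ (p : ℂ) *
        Complex.exp (φ * Complex.I)).im = π * (Gamma (-p))⁻¹ := by
  have hcos : cos φ < 0 := cos_neg_of_pi_div_two_lt_of_lt h1 (by linarith)
  have hφ : 0 < sin φ := sin_pos_of_pos_of_lt_pi (by linarith [pi_pos]) h2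
  refine congrFun (Continuous.ext_on dense_irrational (Complex.continuous_im.comp
    (continuous_integral_exp_mul_cpow_rayPoint hcos hφ hc))
    ((continuous_inv_Gamma.comp continuous_neg).const_mul π) fun q hq ↦ ?_) p
  exact im_integral_exp_mul_cpow_rayPoint_of_irrational h1 h2 hc hq

/-- The integral representation of the Mainardi function on the upper half of a wedge-shaped
contour. -/
lemma mainardi_eq_im_integral {α φ c : ℝ} (hα1 : α < 1) (h1 : π / 2 < φ)
    (h2 : φ < π) (hc : 0 < c) (r : ℝ) :
    mainardi α r = π⁻¹ * (∫ u in Ioi (0 : ℝ), Complex.exp (rayPoint φ c u) *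
      rayPoint φ c u ^ ((α - 1 : ℝ) : ℂ) * Complex.exp (φ * Complex.I) *
      Complex.exp (-r * rayPoint φ c u ^ (α : ℂ))).im := by
  have hcos : cos φ < 0 := cos_neg_of_pi_div_two_lt_of_lt h1 (by linarith)
  have hφ : 0 < sin φ := sin_pos_of_pos_of_lt_pi (by linarith [pi_pos]) h2
  have hsplit : ∀ (n : ℕ) (u : ℝ), rayPoint φ c u ^ ((α * (n + 1) - 1 : ℝ) : ℂ) =
      rayPoint φ c u ^ ((α - 1 : ℝ) : ℂ) * (rayPoint φ c u ^ (α : ℂ)) ^ n := by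
    intro n u
    have hne : rayPoint φ c u ≠ 0 := norm_pos_iff.1 (norm_rayPoint_pos hφ hc)
    rw [← Complex.cpow_nat_mul, ← Complex.cpow_add _ _ hne]
    congr 1; push_cast; ring
  have hexpR : ∀ x : ℝ, HasSum (fun n : ℕ ↦ x ^ n / n.factorial) (exp x) := fun x ↦ by
    rw [Real.exp_eq_exp_ℝ]; exact NormedSpace.expSeries_div_hasSum_exp x
  have hexpC : ∀ x : ℂ, HasSum (fun n : ℕ ↦ x ^ n / n.factorial) (Complex.exp x) := fun x ↦ by
    rw [Complex.exp_eq_exp_ℂ]; exact NormedSpace.expSeries_div_hasSum_exp x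
  have hbound : ∀ u : ℝ, HasSum (fun n : ℕ ↦ ‖Complex.exp (rayPoint φ c u)‖ *
      ‖rayPoint φ c u‖ ^ (α - 1) * ((|r| * ‖rayPoint φ c u‖ ^ α) ^ n / n.factorial))
      (‖Complex.exp (rayPoint φ c u)‖ * ‖rayPoint φ c u‖ ^ (α - 1) *
        exp (|r| * ‖rayPoint φ c u‖ ^ α)) := fun u ↦ (hexpR _).mul_left _
  have hsum := hasSum_integral_of_dominated_convergence (μ := volume.restrict (Ioi (0 : ℝ)))
    (F := fun (n : ℕ) u ↦ (((-r) ^ n / n.factorial : ℝ) : ℂ) * (Complex.exp (rayPoint φ c u) *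
      rayPoint φ c u ^ ((α * (n + 1) - 1 : ℝ) : ℂ) * Complex.exp (φ * Complex.I)))
    (f := fun u ↦ Complex.exp (rayPoint φ c u) *
      rayPoint φ c u ^ ((α - 1 : ℝ) : ℂ) * Complex.exp (φ * Complex.I) *
      Complex.exp (-r * rayPoint φ c u ^ (α : ℂ)))
    (fun n u ↦ ‖Complex.exp (rayPoint φ c u)‖ *
      ‖rayPoint φ c u‖ ^ (α - 1) * ((|r| * ‖rayPoint φ c u‖ ^ α) ^ n / n.factorial))
    ?_ ?_ (Eventually.of_forall fun u ↦ (hbound u).summable) ?_ ?_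
  · have him := (Complex.imCLM.hasSum hsum).mul_left π⁻¹
    rw [Complex.imCLM_apply] at him
    rw [← him.tsum_eq, mainardi]
    refine tsum_congr fun n ↦ ?_
    rw [Complex.imCLM_apply, integral_const_mul, Complex.im_ofReal_mul,
      im_integral_exp_mul_cpow_rayPoint h1 h2 hc,
      show -(α * (n + 1) - 1) = -α * n + 1 - α by ring]
    have := pi_pos.ne'
    field_simp
  · exact fun n ↦
      (((measurable_exp_rayPoint_mul_cpow φ c _).mul_const _).const_mul _).aestronglyMeasurable
  · refine fun n ↦ Eventually.of_forall fun u ↦ le_of_eq ?_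
    rw [hsplit]
    simp only [norm_mul, norm_pow, Complex.norm_cpow_real, Complex.norm_exp_ofReal_mul_I,
      Complex.norm_real, norm_div, norm_neg, Real.norm_eq_abs, Nat.abs_cast]
    ring
  · simp only [(hbound _).tsum_eq]
    exact integrableOn_norm_exp_rayPoint hcos hφ hα1 hc
  · refine Eventually.of_forall fun u ↦ ?_
    convert! (hexpC (-r * rayPoint φ c u ^ (α : ℂ))).mul_left (Complex.exp (rayPoint φ c u) *
      rayPoint φ c u ^ ((α - 1 : ℝ) : ℂ) * Complex.exp (φ * Complex.I)) using 1
    funext n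
    rw [hsplit]
    push_cast
    ring

/-- The integral representation of the Mittag-Leffler function on the upper half of a wedge-shaped
contour. -/
lemma tsum_div_Gamma_eq_im_integral {α φ c lam : ℝ} (hα : 0 < α) (h1 : π / 2 < φ) (h2 : φ < π)
    (hc : 0 < c) (hlam : |lam| < (c * sin φ) ^ α) :
    ∑' n : ℕ, (-lam) ^ n / Gamma (α * n + 1) =
      π⁻¹ * (∫ u in Ioi (0 : ℝ), Complex.exp (rayPoint φ c u) *
        rayPoint φ c u ^ ((α - 1 : ℝ) : ℂ) * Complex.exp (φ * Complex.I) *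
        (lam + rayPoint φ c u ^ (α : ℂ))⁻¹).im := by
  have hcos : cos φ < 0 := cos_neg_of_pi_div_two_lt_of_lt h1 (by linarith)
  have hφ : 0 < sin φ := sin_pos_of_pos_of_lt_pi (by linarith [pi_pos]) h2
  have hne : ∀ u, rayPoint φ c u ≠ 0 := fun u ↦ norm_pos_iff.1 (norm_rayPoint_pos hφ hc)
  have hδ : 0 < (c * sin φ) ^ α := by positivity
  set q : ℝ := |lam| / (c * sin φ) ^ α with hq
  have hq0 : 0 ≤ q := by positivity
  have hq1 : q < 1 := (div_lt_one hδ).2 hlam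
  have hratio : ∀ u, ‖-(lam : ℂ) * (rayPoint φ c u ^ (α : ℂ))⁻¹‖ ≤ q := by
    intro u
    rw [norm_mul, norm_inv, Complex.norm_cpow_real, norm_neg, Complex.norm_real, norm_eq_abs, hq,
      div_eq_mul_inv]
    gcongr
    exact mul_sin_le_norm_rayPoint
  have hsplit : ∀ (n : ℕ) (u : ℝ), rayPoint φ c u ^ ((-(α * n + 1) : ℝ) : ℂ) =
      rayPoint φ c u ^ ((-1 : ℝ) : ℂ) * ((rayPoint φ c u ^ (α : ℂ))⁻¹) ^ n := by
    intro n u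
    rw [← Complex.cpow_neg, ← Complex.cpow_nat_mul, ← Complex.cpow_add _ _ (hne u)]
    congr 1; push_cast; ring
  have hsum := hasSum_integral_of_dominated_convergence (μ := volume.restrict (Ioi (0 : ℝ)))
    (F := fun (n : ℕ) u ↦ (((-lam) ^ n : ℝ) : ℂ) * (Complex.exp (rayPoint φ c u) *
      rayPoint φ c u ^ ((-(α * n + 1) : ℝ) : ℂ) * Complex.exp (φ * Complex.I)))
    (f := fun u ↦ Complex.exp (rayPoint φ c u) *
      rayPoint φ c u ^ ((α - 1 : ℝ) : ℂ) * Complex.exp (φ * Complex.I) *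
      (lam + rayPoint φ c u ^ (α : ℂ))⁻¹)
    (fun n u ↦ ‖Complex.exp (rayPoint φ c u)‖ * ‖rayPoint φ c u‖ ^ (-1 : ℝ) * q ^ n)
    ?_ ?_ (Eventually.of_forall fun u ↦
      (summable_geometric_of_lt_one hq0 hq1).mul_left _) ?_ ?_
  · have him := (Complex.imCLM.hasSum hsum).mul_left π⁻¹
    rw [Complex.imCLM_apply] at him
    rw [← him.tsum_eq]
    refine tsum_congr fun n ↦ ?_
    rw [Complex.imCLM_apply, integral_const_mul, Complex.im_ofReal_mul,
      im_integral_exp_mul_cpow_rayPoint h1 h2 hc, neg_neg]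
    have := pi_pos.ne'
    field_simp
  · exact fun n ↦
      (((measurable_exp_rayPoint_mul_cpow φ c _).mul_const _).const_mul _).aestronglyMeasurable
  · refine fun n ↦ Eventually.of_forall fun u ↦ ?_
    have hle := pow_le_pow_left₀ (norm_nonneg _) (hratio u) n
    refine le_trans (le_of_eq ?_) (mul_le_mul_of_nonneg_left hle (by positivity))
    rw [hsplit, norm_mul, norm_mul, norm_mul, norm_mul, Complex.norm_exp_ofReal_mul_I,
      Complex.norm_cpow_real, ← norm_pow, mul_pow, norm_mul]
    push_cast
    ring
  · simp only [tsum_mul_left]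
    exact (integrableOn_norm_exp_rayPoint_mul_rpow _ hcos hφ hc).mul_const _
  · refine Eventually.of_forall fun u ↦ ?_
    have hgeom := (hasSum_geometric_of_norm_lt_one ((hratio u).trans_lt hq1)).mul_left
      (Complex.exp (rayPoint φ c u) * rayPoint φ c u ^ ((-1 : ℝ) : ℂ) *
        Complex.exp (φ * Complex.I))
    have hpow : rayPoint φ c u ^ (α : ℂ) ≠ 0 := by simp [Complex.cpow_eq_zero_iff, hne u]
    have hval : rayPoint φ c u ^ ((α - 1 : ℝ) : ℂ) * (lam + rayPoint φ c u ^ (α : ℂ))⁻¹ =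
        rayPoint φ c u ^ ((-1 : ℝ) : ℂ) * (1 - -(lam : ℂ) * (rayPoint φ c u ^ (α : ℂ))⁻¹)⁻¹ := by
      have hadd : rayPoint φ c u ^ ((α - 1 : ℝ) : ℂ) =
          rayPoint φ c u ^ ((-1 : ℝ) : ℂ) * rayPoint φ c u ^ (α : ℂ) := by
        rw [← Complex.cpow_add _ _ (hne u)]; congr 1; push_cast; ring
      have hsub : 1 - -(lam : ℂ) * (rayPoint φ c u ^ (α : ℂ))⁻¹ =
          (lam + rayPoint φ c u ^ (α : ℂ)) * (rayPoint φ c u ^ (α : ℂ))⁻¹ := by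
        field_simp; ring
      rw [hadd, hsub, mul_inv, inv_inv]; ring
    rw [mul_right_comm _ (Complex.exp (φ * Complex.I)), mul_assoc (Complex.exp (rayPoint φ c u)),
      hval]
    convert! hgeom using 1
    · funext n
      rw [hsplit]; push_cast; ring
    · ring

theorem mainardi_laplace (α lam : ℝ) (hα : α ∈ Set.Ioo (0 : ℝ) 1) (hlam : 0 ≤ lam) :
    ∫ r in Set.Ioi (0 : ℝ), Real.exp (-r * lam) * mainardi α r =
      ∑' n : ℕ, (-lam) ^ n / Real.Gamma (α * n + 1) := by
  obtain ⟨hα0, hα1⟩ := hα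
  obtain ⟨φ, h1, h2, hαφ⟩ : ∃ φ, π / 2 < φ ∧ φ < π ∧ α * φ < π / 2 := by
    refine ⟨π / (1 + α), ?_, ?_, ?_⟩
    · exact div_lt_div_of_pos_left pi_pos (by linarith) (by linarith)
    · rw [div_lt_iff₀ (by linarith)]; nlinarith [pi_pos]
    · rw [← mul_div_assoc, div_lt_iff₀ (by linarith)]; nlinarith [pi_pos]
  have hcos : cos φ < 0 := cos_neg_of_pi_div_two_lt_of_lt h1 (by linarith)
  have h0 : 0 < φ := by linarith [pi_pos]
  have hφ : 0 < sin φ := sin_pos_of_pos_of_lt_pi h0 h2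
  obtain ⟨c, hc, hclam⟩ : ∃ c, 0 < c ∧ |lam| < (c * sin φ) ^ α := by
    refine ⟨(lam + 1) ^ α⁻¹ / sin φ, by positivity, ?_⟩
    rw [div_mul_cancel₀ _ hφ.ne', ← rpow_mul (by positivity), inv_mul_cancel₀ hα0.ne', rpow_one,
      abs_of_nonneg hlam]
    linarith
  set δ : ℝ := (c * sin φ) ^ α * cos (α * φ)
  have hδ0 : 0 < δ :=
    mul_pos (by positivity) (cos_pos_of_mem_Ioo ⟨by nlinarith [pi_pos], hαφ⟩)
  have hre : ∀ u ∈ Ioi (0 : ℝ), δ ≤ (lam + rayPoint φ c u ^ (α : ℂ)).re := by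
    intro u hu
    have := le_re_rayPoint_cpow hα0 h0 h2 hαφ hc (le_of_lt hu)
    rw [Complex.add_re, Complex.ofReal_re]
    linarith
  set A : ℝ → ℂ := fun u ↦ Complex.exp (rayPoint φ c u) *
    rayPoint φ c u ^ ((α - 1 : ℝ) : ℂ) * Complex.exp (φ * Complex.I) with hA
  have hAi : IntegrableOn A (Ioi 0) :=
    (integrableOn_exp_rayPoint_mul_cpow (α - 1) hcos hφ hc).mul_const _
  have hprod : Integrable (Function.uncurry fun r u : ℝ ↦
      A u * Complex.exp (-(lam + rayPoint φ c u ^ (α : ℂ)) * r))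
      ((volume.restrict (Ioi 0)).prod (volume.restrict (Ioi 0))) := by
    have hexp : IntegrableOn (fun r ↦ exp (-δ * r)) (Ioi 0) :=
      integrableOn_exp_mul_Ioi (by linarith) 0
    refine (hexp.mul_prod hAi.norm).mono' ?_ ?_
    · have := measurable_rayPoint_right φ c
      simp only [hA, Function.uncurry_def]
      exact (by fun_prop : Measurable _).aestronglyMeasurable
    · rw [Measure.prod_restrict, ae_restrict_iff' (measurableSet_Ioi.prod measurableSet_Ioi)]
      refine Eventually.of_forall fun z hz ↦ ?_
      have hr : 0 < z.1 := hz.1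
      have hu := hre z.2 hz.2
      rw [Function.uncurry_def, norm_mul, Complex.norm_exp, Complex.re_mul_ofReal, Complex.neg_re,
        mul_comm]
      gcongr
  have hpoint : ∀ r : ℝ, exp (-r * lam) * mainardi α r = π⁻¹ * Complex.imCLM
      (∫ u in Ioi (0 : ℝ), A u * Complex.exp (-(lam + rayPoint φ c u ^ (α : ℂ)) * r)) := by
    intro r
    rw [mainardi_eq_im_integral hα1 h1 h2 hc, Complex.imCLM_apply, mul_left_comm,
      ← Complex.im_ofReal_mul, ← integral_const_mul]
    congr 3
    funext u
    simp only [hA]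
    rw [Complex.ofReal_exp, mul_left_comm, ← Complex.exp_add]
    congr 2
    push_cast
    ring
  simp only [hpoint]
  have hcomm := Complex.imCLM.integral_comp_comm hprod.integral_prod_left
  simp only [Function.uncurry_apply_pair] at hcomm
  rw [integral_const_mul, hcomm,
    integral_integral_swap hprod, tsum_div_Gamma_eq_im_integral hα0 h1 h2 hc hclam,
    Complex.imCLM_apply]
  congr 2
  refine setIntegral_congr_fun measurableSet_Ioi fun u hu ↦ ?_
  have hneg : (-(lam + rayPoint φ c u ^ (α : ℂ))).re < 0 := by
    rw [Complex.neg_re]; linarith [hre u hu]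
  simp only [integral_const_mul]
  rw [integral_exp_mul_complex_Ioi hneg, neg_div_neg_eq, Complex.ofReal_zero, mul_zero,
    Complex.exp_zero, one_div]
end

section
/- Let T(t) be a strongly continuous semigroup with ‖T(t)‖ ≤ M e^{ωt}, M ≥ 1, ω ≥ 0, and for 0 < α < 1 define T_α(t) = ∫₀^∞ M_α(r) T(t^α r) dr. Then ‖T_α(t)‖ ≤ M E_α(ω t^α) for all t ≥ 0, where E_α(z) = Σ_{n=0}^∞ z^n / Γ(αn + 1). -/
open Real MeasureTheory

open Filter Topology Finset

/-- The coefficient of `z ^ m` in `(1 - z) ^ (-s)`. -/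
noncomputable def negBinom (s : ℝ) (m : ℕ) : ℝ := ∏ j ∈ range m, (s + j) / (j + 1)

lemma negBinom_zero (s : ℝ) : negBinom s 0 = 1 := by simp [negBinom]

lemma negBinom_succ (s : ℝ) (m : ℕ) :
    negBinom s (m + 1) = negBinom s m * ((s + m) / (m + 1)) := by
  rw [negBinom, negBinom, prod_range_succ]

lemma succ_mul_negBinom_succ (s : ℝ) (m : ℕ) :
    (m + 1) * negBinom s (m + 1) = (s + m) * negBinom s m := by
  have : (m : ℝ) + 1 ≠ 0 := by positivity
  rw [negBinom_succ]; field_simp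

lemma succ_mul_negBinom_succ_eq_shift (s : ℝ) (m : ℕ) :
    (m + 1) * negBinom s (m + 1) = s * negBinom (s + 1) m := by
  induction m with
  | zero => simp [negBinom]
  | succ m ih =>
    have h : (m : ℝ) + 1 ≠ 0 := by positivity
    rw [succ_mul_negBinom_succ, negBinom_succ (s + 1) m]
    push_cast
    field_simp
    linear_combination (s + m + 1) * ih

lemma negBinom_nonneg {s : ℝ} (hs : 0 ≤ s) (m : ℕ) : 0 ≤ negBinom s m :=
  prod_nonneg fun _ _ => by positivity

/-- Vandermonde's identity: `(1 - z) ^ (-(s + t)) = (1 - z) ^ (-s) * (1 - z) ^ (-t)`. -/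
lemma negBinom_add (s t : ℝ) (m : ℕ) :
    negBinom (s + t) m = ∑ p ∈ antidiagonal m, negBinom s p.1 * negBinom t p.2 := by
  induction m with
  | zero => simp [negBinom]
  | succ m ih =>
    have h : (m : ℝ) + 1 ≠ 0 := by positivity
    apply mul_left_cancel₀ h
    have split : (m + 1 : ℝ) * ∑ p ∈ antidiagonal (m + 1), negBinom s p.1 * negBinom t p.2 =
        (∑ p ∈ antidiagonal (m + 1), (p.1 : ℝ) * (negBinom s p.1 * negBinom t p.2)) +
        ∑ p ∈ antidiagonal (m + 1), (p.2 : ℝ) * (negBinom s p.1 * negBinom t p.2) := by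
      rw [mul_sum, ← sum_add_distrib]
      refine sum_congr rfl fun p hp => ?_
      have : (p.1 : ℝ) + p.2 = m + 1 := mod_cast mem_antidiagonal.1 hp
      rw [← this]; ring
    rw [succ_mul_negBinom_succ, ih, split, Nat.sum_antidiagonal_succ, Nat.sum_antidiagonal_succ',
      mul_sum]
    simp only [Nat.cast_zero, zero_mul, zero_add, ← sum_add_distrib]
    refine sum_congr rfl fun p hp => ?_
    have hp' : (p.1 : ℝ) + p.2 = m := mod_cast mem_antidiagonal.1 hp
    push_cast
    linear_combination (-negBinom t p.2) * succ_mul_negBinom_succ s p.1 -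
      negBinom s p.1 * succ_mul_negBinom_succ t p.2 - negBinom s p.1 * negBinom t p.2 * hp'

lemma abs_negBinom_le (s : ℝ) (m : ℕ) : |negBinom s m| ≤ m.factorial * exp (|s| + 1) := by
  have h : |negBinom s m| ≤ (|s| + 1) ^ m := by
    rw [negBinom, abs_prod]
    refine (prod_le_prod (fun _ _ => abs_nonneg _) fun j _ => ?_).trans_eq
      (by rw [prod_const, card_range])
    have hj : (0 : ℝ) < j + 1 := by positivity
    rw [abs_div, abs_of_pos hj, div_le_iff₀ hj]
    have := abs_add_le s j
    rw [Nat.abs_cast] at this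
    nlinarith [mul_nonneg (abs_nonneg s) (Nat.cast_nonneg (α := ℝ) j)]
  have := pow_div_factorial_le_exp (|s| + 1) (by positivity) m
  rw [div_le_iff₀ (by positivity)] at this
  linarith

/-- Euler's limit formula, valid also at the poles of `Γ` with the convention `1 / 0 = 0`. -/
lemma tendsto_rpow_mul_negBinom (s : ℝ) :
    Tendsto (fun m : ℕ => (m : ℝ) ^ (1 - s) * negBinom s m) atTop (𝓝 (Gamma s)⁻¹) := by
  by_cases hs : ∃ N : ℕ, s = -N
  · obtain ⟨N, rfl⟩ := hs
    rw [Real.Gamma_neg_nat_eq_zero, inv_zero]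
    refine tendsto_const_nhds.congr' ?_
    filter_upwards [eventually_gt_atTop N] with m hm
    have : negBinom (-(N : ℝ)) m = 0 := prod_eq_zero (mem_range.2 hm) (by simp)
    simp [this]
  · push Not at hs
    have h1 := (GammaSeq_tendsto_Gamma s).inv₀ (Gamma_ne_zero hs)
    have h2 : Tendsto (fun m : ℕ => (m : ℝ) / (s + m)) atTop (𝓝 1) := by
      simpa [add_comm] using tendsto_natCast_div_add_atTop s
    have h3 := h1.mul h2
    rw [mul_one] at h3
    refine h3.congr' ?_
    filter_upwards [eventually_gt_atTop 0] with m hm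
    have hm' : (0 : ℝ) < m := mod_cast hm
    have hsm : s + m ≠ 0 := fun h => hs m (by linarith)
    have hfac : (∏ j ∈ range m, ((j : ℝ) + 1)) = m.factorial := by
      rw [← prod_range_add_one_eq_factorial]; push_cast; rfl
    have hf0 : (m.factorial : ℝ) ≠ 0 := by positivity
    have hp0 : (m : ℝ) ^ s ≠ 0 := (rpow_pos_of_pos hm' s).ne'
    rw [GammaSeq, negBinom, prod_div_distrib, hfac, prod_range_succ, rpow_sub hm', rpow_one]
    field_simp

lemma rpow_mul_abs_negBinom_le {p : ℝ} (hp : 0 < p) (m : ℕ) :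
    ((m : ℝ) + 1) ^ p * |negBinom (1 - p) m| ≤ (p + 1) ^ p * exp p := by
  have small : ∀ m : ℕ, (m : ℝ) ≤ p ∨ m = 0 →
      ((m : ℝ) + 1) ^ p * |negBinom (1 - p) m| ≤ (p + 1) ^ p * exp p := by
    intro m hm
    have hmp : (m : ℝ) ≤ p := by
      rcases hm with h | rfl
      · exact h
      · simpa using hp.le
    refine mul_le_mul (rpow_le_rpow (by positivity) (by linarith) hp.le) ?_ (abs_nonneg _)
      (by positivity)
    refine le_trans ?_ (pow_div_factorial_le_exp p hp.le m)
    rw [negBinom, prod_div_distrib, abs_div, abs_prod]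
    have hfac : (∏ j ∈ range m, ((j : ℝ) + 1)) = m.factorial := by
      rw [← prod_range_add_one_eq_factorial]; push_cast; rfl
    rw [hfac, Nat.abs_cast]
    gcongr
    refine (prod_le_prod (fun _ _ => abs_nonneg _) fun j hj => ?_).trans_eq
      (by rw [prod_const, card_range])
    have : (j : ℝ) + 1 ≤ m := mod_cast mem_range.1 hj
    rw [abs_le]
    constructor <;> linarith [Nat.cast_nonneg (α := ℝ) j]
  induction m with
  | zero => exact small 0 (Or.inr rfl)
  | succ m ih =>
    by_cases hm : ((m + 1 : ℕ) : ℝ) ≤ p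
    · exact small _ (Or.inl hm)
    · refine le_trans ?_ ih
      push_cast at hm ⊢
      have hm1 : (0 : ℝ) < m + 1 := by positivity
      have hm2 : (0 : ℝ) < m + 1 + 1 := by positivity
      have hq : 0 ≤ (1 - p + m) / (m + 1) := div_nonneg (by linarith) hm1.le
      rw [negBinom_succ, abs_mul, abs_of_nonneg hq]
      have key : ((m : ℝ) + 1 + 1) ^ p * ((1 - p + m) / (m + 1)) ≤ ((m : ℝ) + 1) ^ p := by
        have h1 : (1 - p + m) / (m + 1) ≤ exp (-(p / (m + 1))) := by
          have := add_one_le_exp (-(p / ((m : ℝ) + 1)))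
          have e : (1 - p + m) / ((m : ℝ) + 1) = -(p / (m + 1)) + 1 := by field_simp; ring
          linarith
        have h2 : ((m : ℝ) + 1 + 1) ^ p ≤ ((m : ℝ) + 1) ^ p * exp (p / (m + 1)) := by
          have h3 : (m : ℝ) + 1 + 1 ≤ (m + 1) * exp (1 / (m + 1)) := by
            have := add_one_le_exp (1 / ((m : ℝ) + 1))
            calc (m : ℝ) + 1 + 1 = (m + 1) * (1 / (m + 1) + 1) := by field_simp; ring
              _ ≤ _ := by gcongr
          calc _ ≤ (((m : ℝ) + 1) * exp (1 / (m + 1))) ^ p := rpow_le_rpow hm2.le h3 hp.le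
            _ = _ := by
              rw [mul_rpow hm1.le (exp_pos _).le, ← exp_mul]; congr 2; ring
        calc _ ≤ (((m : ℝ) + 1) ^ p * exp (p / (m + 1))) * exp (-(p / (m + 1))) :=
              mul_le_mul h2 h1 hq (by positivity)
          _ = _ := by rw [mul_assoc, ← exp_add]; simp
      calc _ = (((m : ℝ) + 1 + 1) ^ p * ((1 - p + m) / (m + 1))) * |negBinom (1 - p) m| := by ring
        _ ≤ _ := by gcongr

/-- The coefficient of `z ^ m` in `(1 - z) ^ (-β) * exp (-c * (1 - z) ^ α)`. -/
noncomputable def expCoeff (α β c : ℝ) (m : ℕ) : ℝ :=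
  ∑' n : ℕ, (-c) ^ n / n.factorial * negBinom (β - α * n) m

lemma summable_expCoeff (α β c : ℝ) (m : ℕ) :
    Summable fun n : ℕ => (-c) ^ n / n.factorial * negBinom (β - α * n) m := by
  refine Summable.of_norm_bounded
    ((Real.summable_pow_div_factorial (|c| * exp |α|)).mul_left
      (m.factorial * exp (|β| + 1))) fun n => ?_
  rw [norm_mul, norm_div, norm_pow, norm_neg, Real.norm_eq_abs, Real.norm_eq_abs,
    Real.norm_eq_abs, Nat.abs_cast]
  have h : |negBinom (β - α * n) m| ≤ m.factorial * exp (|β| + 1) * exp |α| ^ n := by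
    refine (abs_negBinom_le _ _).trans ?_
    rw [mul_assoc, ← exp_nat_mul, ← exp_add]
    refine mul_le_mul_of_nonneg_left (exp_le_exp.2 ?_) (by positivity)
    have := abs_sub β (α * n)
    rw [abs_mul, Nat.abs_cast] at this
    linarith
  calc _ ≤ |c| ^ n / n.factorial * (m.factorial * exp (|β| + 1) * exp |α| ^ n) := by gcongr
    _ = _ := by rw [mul_pow]; ring

lemma expCoeff_zero (α β c : ℝ) : expCoeff α β c 0 = exp (-c) := by
  simp only [expCoeff, negBinom_zero, mul_one]
  rw [Real.exp_eq_exp_ℝ, NormedSpace.exp_eq_tsum_div]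

lemma expCoeff_add (α β γ c : ℝ) (m : ℕ) :
    expCoeff α (β + γ) c m =
      ∑ p ∈ antidiagonal m, negBinom β p.1 * expCoeff α γ c p.2 := by
  simp only [expCoeff, ← tsum_mul_left]
  have hs : ∀ p ∈ antidiagonal m, Summable fun n : ℕ =>
      negBinom β p.1 * ((-c) ^ n / n.factorial * negBinom (γ - α * n) p.2) :=
    fun p _ => (summable_expCoeff α γ c p.2).mul_left _
  rw [← Summable.tsum_finsetSum hs]
  refine tsum_congr fun n => ?_
  rw [add_sub_assoc, negBinom_add, mul_sum]
  exact sum_congr rfl fun p _ => by ring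

lemma succ_mul_expCoeff_succ (α c : ℝ) (m : ℕ) :
    (m + 1) * expCoeff α 0 c (m + 1) = α * c * expCoeff α (1 - α) c m := by
  simp only [expCoeff, ← tsum_mul_left]
  rw [((summable_expCoeff α 0 c (m + 1)).mul_left _).tsum_eq_zero_add]
  have h0 : negBinom 0 (m + 1) = 0 := prod_eq_zero (mem_range.2 m.succ_pos) (by simp)
  simp only [Nat.cast_zero, mul_zero, sub_zero, h0, zero_add]
  refine tsum_congr fun n => ?_
  have := succ_mul_negBinom_succ_eq_shift (0 - α * (n + 1 : ℕ)) m
  rw [mul_left_comm, this, Nat.factorial_succ]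
  have e : 0 - α * ((n + 1 : ℕ) : ℝ) + 1 = 1 - α - α * n := by push_cast; ring
  rw [e]
  have : (n.factorial : ℝ) ≠ 0 := by positivity
  push_cast
  field_simp
  ring

lemma expCoeff_zero_left_nonneg {α c : ℝ} (hα : α ∈ Set.Ioo (0 : ℝ) 1) (hc : 0 ≤ c) (m : ℕ) :
    0 ≤ expCoeff α 0 c m := by
  induction m using Nat.strong_induction_on with
  | _ m ih =>
    cases m with
    | zero => rw [expCoeff_zero]; positivity
    | succ m =>
      have h : 0 ≤ expCoeff α (1 - α + 0) c m := by
        rw [expCoeff_add]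
        exact sum_nonneg fun p hp => mul_nonneg (negBinom_nonneg (by linarith [hα.2]) _)
          (ih _ (Nat.lt_succ_of_le (mem_antidiagonal.1 hp ▸ Nat.le_add_left _ _)))
      rw [add_zero] at h
      have h2 := succ_mul_expCoeff_succ α c m
      have h3 : 0 ≤ α * c * expCoeff α (1 - α) c m := mul_nonneg (mul_nonneg hα.1.le hc) h
      rw [← h2] at h3
      exact nonneg_of_mul_nonneg_right h3 (by positivity)

lemma expCoeff_one_sub_eq_sum (α c : ℝ) (m : ℕ) : expCoeff α (1 - α) c m =
    ∑ p ∈ antidiagonal m, negBinom (1 - α) p.1 * expCoeff α 0 c p.2 := by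
  rw [← expCoeff_add, add_zero]

lemma expCoeff_one_sub_nonneg {α c : ℝ} (hα : α ∈ Set.Ioo (0 : ℝ) 1) (hc : 0 ≤ c) (m : ℕ) :
    0 ≤ expCoeff α (1 - α) c m := by
  rw [expCoeff_one_sub_eq_sum]
  exact sum_nonneg fun p _ => mul_nonneg (negBinom_nonneg (by linarith [hα.2]) _)
    (expCoeff_zero_left_nonneg hα hc _)

/-- If the moments of `expCoeff α 0 · j` are known for `j ≤ m`, so are those of
`expCoeff α (1 - α) · m`. -/
lemma moment_expCoeff_one_sub_of_moment {α : ℝ} {m : ℕ}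
    (h : ∀ j ≤ m, ∀ k : ℕ, IntegrableOn (fun c => c ^ k * expCoeff α 0 c j) (Set.Ioi 0) ∧
      ∫ c in Set.Ioi (0 : ℝ), c ^ k * expCoeff α 0 c j =
        k.factorial * negBinom (α * (k + 1)) j) (k : ℕ) :
    IntegrableOn (fun c => c ^ k * expCoeff α (1 - α) c m) (Set.Ioi 0) ∧
      ∫ c in Set.Ioi (0 : ℝ), c ^ k * expCoeff α (1 - α) c m =
        k.factorial * negBinom (α * k + 1) m := by
  have e : (fun c => c ^ k * expCoeff α (1 - α) c m) = fun c =>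
      ∑ p ∈ antidiagonal m, negBinom (1 - α) p.1 * (c ^ k * expCoeff α 0 c p.2) := by
    funext c
    rw [expCoeff_one_sub_eq_sum, mul_sum]
    exact sum_congr rfl fun p _ => by ring
  have hi : ∀ p ∈ antidiagonal m, IntegrableOn
      (fun c => negBinom (1 - α) p.1 * (c ^ k * expCoeff α 0 c p.2)) (Set.Ioi 0) := fun p hp =>
    ((h _ (mem_antidiagonal.1 hp ▸ Nat.le_add_left _ _) k).1).const_mul _
  rw [e]
  refine ⟨integrable_finsetSum _ hi, ?_⟩
  rw [integral_finsetSum _ hi, show α * k + 1 = (1 - α) + α * (k + 1) by ring, negBinom_add,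
    mul_sum]
  refine sum_congr rfl fun p hp => ?_
  rw [integral_const_mul, (h _ (mem_antidiagonal.1 hp ▸ Nat.le_add_left _ _) k).2]
  ring

lemma moment_expCoeff_zero (α : ℝ) (m : ℕ) : ∀ k : ℕ,
    IntegrableOn (fun c => c ^ k * expCoeff α 0 c m) (Set.Ioi 0) ∧
      ∫ c in Set.Ioi (0 : ℝ), c ^ k * expCoeff α 0 c m =
        k.factorial * negBinom (α * (k + 1)) m := by
  induction m using Nat.strong_induction_on with
  | _ m ih =>
    intro k
    cases m with
    | zero =>
      have hk : (0 : ℝ) < k + 1 := by positivity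
      have e : ∀ c : ℝ, c ^ k * expCoeff α 0 c 0 = exp (-c) * c ^ ((k : ℝ) + 1 - 1) := by
        intro c
        rw [expCoeff_zero, add_sub_cancel_right, rpow_natCast, mul_comm]
      simp only [e, negBinom_zero, mul_one]
      exact ⟨GammaIntegral_convergent hk, by rw [← Gamma_eq_integral hk, Gamma_nat_eq_factorial]⟩
    | succ m =>
      have h := moment_expCoeff_one_sub_of_moment
        (fun j hj => ih j (Nat.lt_succ_of_le hj)) (k + 1)
      have hm : (m : ℝ) + 1 ≠ 0 := by positivity
      have e : (fun c => c ^ k * expCoeff α 0 c (m + 1)) = fun c =>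
          α / (m + 1) * (c ^ (k + 1) * expCoeff α (1 - α) c m) := by
        funext c
        have := succ_mul_expCoeff_succ α c m
        field_simp
        rw [mul_assoc, mul_comm (expCoeff α 0 c (m + 1)), this]
        ring
      rw [e]
      refine ⟨h.1.const_mul _, ?_⟩
      have h2 := succ_mul_negBinom_succ_eq_shift (α * (k + 1)) m
      rw [integral_const_mul, h.2, Nat.factorial_succ]
      push_cast
      field_simp
      linear_combination -h2

lemma moment_expCoeff_one_sub (α : ℝ) (m k : ℕ) :
    IntegrableOn (fun c => c ^ k * expCoeff α (1 - α) c m) (Set.Ioi 0) ∧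
      ∫ c in Set.Ioi (0 : ℝ), c ^ k * expCoeff α (1 - α) c m =
        k.factorial * negBinom (α * k + 1) m :=
  moment_expCoeff_one_sub_of_moment (fun j _ => moment_expCoeff_zero α j) k

lemma summable_pow_div_factorial_mul_rpow_mul_exp {α r : ℝ} (hα : α ∈ Set.Ioo (0 : ℝ) 1)
    (hr : 0 ≤ r) :
    Summable fun n : ℕ => r ^ n / n.factorial *
      ((α * (n + 1) + 1) ^ (α * (n + 1)) * exp (α * (n + 1))) := by
  obtain ⟨hα0, hα1⟩ := hα
  set ε : ℝ := (2 * exp 2 * (r + 1))⁻¹ with hε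
  have hε0 : 0 < ε := by positivity
  have hεr : r * ε * exp 2 ≤ 1 / 2 := by
    rw [hε, mul_right_comm, ← div_eq_mul_inv, div_le_iff₀ (by positivity)]
    nlinarith [exp_pos 2]
  have hsum : Summable fun n : ℕ => ε * exp 3 * (((n : ℝ) + 1) * (1 / 2) ^ n) := by
    refine Summable.mul_left _ ?_
    have h1 := summable_pow_mul_geometric_of_norm_lt_one (R := ℝ) 1 (r := 1 / 2) (by norm_num)
    have h0 := summable_pow_mul_geometric_of_norm_lt_one (R := ℝ) 0 (r := 1 / 2) (by norm_num)
    refine (h1.add h0).congr fun n => ?_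
    ring
  refine Summable.of_norm_bounded_eventually_nat hsum ?_
  have hlim : Tendsto (fun n : ℕ => ((n : ℝ) + 2) ^ (-(1 - α))) atTop (𝓝 0) :=
    (tendsto_rpow_neg_atTop (by linarith)).comp
      (tendsto_atTop_add_const_right _ _ tendsto_natCast_atTop_atTop)
  filter_upwards [hlim.eventually_lt_const hε0] with n hn
  have hn2 : (0 : ℝ) < n + 2 := by positivity
  have hpow : ((n : ℝ) + 2) ^ α ≤ ε * (n + 2) := by
    rw [show α = -(1 - α) + 1 by ring, rpow_add hn2, rpow_one]
    gcongr
  have hp0 : 0 ≤ α * ((n : ℝ) + 1) := by positivity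
  have hp1 : α * ((n : ℝ) + 1) ≤ n + 1 := by nlinarith [Nat.cast_nonneg (α := ℝ) n]
  have hA : (α * ((n : ℝ) + 1) + 1) ^ (α * ((n : ℝ) + 1)) ≤
      ε ^ (n + 1) * ((n + 1).factorial * exp (n + 2)) := by
    calc _ ≤ ((n : ℝ) + 2) ^ (α * ((n : ℝ) + 1)) :=
          rpow_le_rpow (by positivity) (by linarith) hp0
      _ = (((n : ℝ) + 2) ^ α) ^ (n + 1) := by
          rw [rpow_mul hn2.le, ← rpow_natCast]; push_cast; rfl
      _ ≤ (ε * (n + 2)) ^ (n + 1) := by gcongr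
      _ = ε ^ (n + 1) * ((n : ℝ) + 2) ^ (n + 1) := mul_pow _ _ _
      _ ≤ _ := by
          have := pow_div_factorial_le_exp ((n : ℝ) + 2) hn2.le (n + 1)
          rw [div_le_iff₀ (by positivity)] at this
          gcongr
          linarith
  rw [Real.norm_of_nonneg (by positivity)]
  calc _ ≤ r ^ n / n.factorial *
        ((ε ^ (n + 1) * ((n + 1).factorial * exp (n + 2))) * exp (n + 1)) := by gcongr
    _ = ε * exp 3 * ((n + 1) * (r * ε * exp 2) ^ n) := by
        have e : exp ((n : ℝ) + 2) * exp (n + 1) = exp 3 * exp 2 ^ n := by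
          rw [← exp_nat_mul, ← exp_add, ← exp_add]; congr 1; ring
        rw [Nat.factorial_succ]
        have : (n.factorial : ℝ) ≠ 0 := by positivity
        push_cast
        rw [mul_pow, mul_pow]
        clear_value ε
        field_simp
        linear_combination (r ^ n * ε ^ (n + 1)) * e
    _ ≤ _ := by gcongr

/-- Rescaled coefficients of `(1 - z) ^ (α - 1) * exp (-c * (1 - z) ^ α)`, which converge to the
Mainardi function. -/
noncomputable def mainardiApprox (α : ℝ) (m : ℕ) (r : ℝ) : ℝ :=
  (m : ℝ) ^ α * expCoeff α (1 - α) ((m : ℝ) ^ α * r) m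

lemma mainardiApprox_nonneg {α r : ℝ} (hα : α ∈ Set.Ioo (0 : ℝ) 1) (hr : 0 ≤ r) (m : ℕ) :
    0 ≤ mainardiApprox α m r :=
  mul_nonneg (by positivity) (expCoeff_one_sub_nonneg hα (by positivity) m)

lemma tendsto_mainardiApprox {α r : ℝ} (hα : α ∈ Set.Ioo (0 : ℝ) 1) (hr : 0 ≤ r) :
    Tendsto (fun m => mainardiApprox α m r) atTop (𝓝 (mainardi α r)) := by
  have hterm : ∀ (m n : ℕ), 0 < m →
      (m : ℝ) ^ α * ((-((m : ℝ) ^ α * r)) ^ n / n.factorial * negBinom (1 - α - α * n) m) =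
      (-r) ^ n / n.factorial *
        ((m : ℝ) ^ (1 - (1 - α - α * n)) * negBinom (1 - α - α * n) m) := by
    intro m n hm
    have hm' : (0 : ℝ) < m := mod_cast hm
    rw [show 1 - (1 - α - α * (n : ℝ)) = α + α * n by ring, rpow_add hm', rpow_mul hm'.le,
      rpow_natCast, show -((m : ℝ) ^ α * r) = (m : ℝ) ^ α * (-r) by ring, mul_pow]
    ring
  simp only [mainardiApprox, expCoeff, mainardi, ← tsum_mul_left]
  refine tendsto_tsum_of_dominated_convergence
    (summable_pow_div_factorial_mul_rpow_mul_exp hα hr) (fun n => ?_) ?_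
  · have h := (tendsto_rpow_mul_negBinom (1 - α - α * n)).const_mul ((-r) ^ n / n.factorial)
    rw [show -α * (n : ℝ) + 1 - α = 1 - α - α * n by ring, ← div_div, div_eq_mul_inv _ (Gamma _)]
    refine h.congr' ?_
    filter_upwards [eventually_gt_atTop 0] with m hm using (hterm m n hm).symm
  · filter_upwards [eventually_gt_atTop 0] with m hm n
    have hp : 0 < α * ((n : ℝ) + 1) := mul_pos hα.1 (by positivity)
    rw [hterm m n hm, norm_mul, norm_div, norm_pow, norm_neg, Real.norm_of_nonneg hr, norm_natCast,
      norm_mul, Real.norm_of_nonneg (by positivity : (0 : ℝ) ≤ (m : ℝ) ^ (1 - (1 - α - α * n))),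
      Real.norm_eq_abs, show 1 - α - α * (n : ℝ) = 1 - α * (n + 1) by ring, sub_sub_cancel]
    refine mul_le_mul_of_nonneg_left (le_trans ?_ (rpow_mul_abs_negBinom_le hp m)) (by positivity)
    gcongr
    linarith

lemma mainardi_nonneg {α r : ℝ} (hα : α ∈ Set.Ioo (0 : ℝ) 1) (hr : 0 ≤ r) : 0 ≤ mainardi α r :=
  ge_of_tendsto' (tendsto_mainardiApprox hα hr) (mainardiApprox_nonneg hα hr)

lemma moment_mainardiApprox (α : ℝ) {m : ℕ} (hm : 0 < m) (k : ℕ) :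
    IntegrableOn (fun r => r ^ k * mainardiApprox α m r) (Set.Ioi 0) ∧
      ∫ r in Set.Ioi (0 : ℝ), r ^ k * mainardiApprox α m r =
        k.factorial * ((m : ℝ) ^ (1 - (α * k + 1)) * negBinom (α * k + 1) m) := by
  have hm' : (0 : ℝ) < m := mod_cast hm
  set b : ℝ := (m : ℝ) ^ α with hb
  have hb0 : 0 < b := rpow_pos_of_pos hm' α
  obtain ⟨hi, hv⟩ := moment_expCoeff_one_sub α m k
  have e : (fun r => r ^ k * mainardiApprox α m r) = fun r =>
      (b / b ^ k) * ((b * r) ^ k * expCoeff α (1 - α) (b * r) m) := by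
    funext r
    rw [mainardiApprox, mul_pow, ← hb]
    field_simp
  have hbk : (m : ℝ) ^ (1 - (α * k + 1)) = (b ^ k)⁻¹ := by
    rw [show 1 - (α * k + 1) = -(α * k) by ring, rpow_neg hm'.le, rpow_mul hm'.le, rpow_natCast]
  rw [e, hbk]
  constructor
  · refine Integrable.const_mul ?_ _
    refine (integrableOn_Ioi_comp_mul_left_iff
      (fun c => c ^ k * expCoeff α (1 - α) c m) 0 hb0).2 ?_
    rwa [mul_zero]
  · rw [integral_const_mul,
      integral_comp_mul_left_Ioi (fun c => c ^ k * expCoeff α (1 - α) c m) 0 hb0, mul_zero, hv,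
      smul_eq_mul]
    field_simp

lemma aemeasurable_mainardi {α : ℝ} (hα : α ∈ Set.Ioo (0 : ℝ) 1) :
    AEMeasurable (mainardi α) (volume.restrict (Set.Ioi 0)) := by
  refine aemeasurable_of_tendsto_metrizable_ae atTop (f := fun m => mainardiApprox α (m + 1))
    (fun m => ?_) ?_
  · simpa using (moment_mainardiApprox α m.succ_pos 0).1.aemeasurable
  · filter_upwards [ae_restrict_mem measurableSet_Ioi] with r hr
    exact (tendsto_mainardiApprox hα (le_of_lt hr)).comp (tendsto_add_atTop_nat 1)

lemma lintegral_pow_mul_mainardi_le {α : ℝ} (hα : α ∈ Set.Ioo (0 : ℝ) 1) (k : ℕ) :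
    ∫⁻ r in Set.Ioi (0 : ℝ), ENNReal.ofReal (r ^ k * mainardi α r) ≤
      ENNReal.ofReal (k.factorial / Gamma (α * k + 1)) := by
  set f : ℕ → ℝ → ENNReal := fun m r => ENNReal.ofReal (r ^ k * mainardiApprox α (m + 1) r)
  have hf : ∀ m, AEMeasurable (f m) (volume.restrict (Set.Ioi 0)) := fun m =>
    (moment_mainardiApprox α m.succ_pos k).1.aemeasurable.ennreal_ofReal
  have hlim : ∀ᵐ r ∂volume.restrict (Set.Ioi (0 : ℝ)),
      ENNReal.ofReal (r ^ k * mainardi α r) = liminf (fun m => f m r) atTop := by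
    filter_upwards [ae_restrict_mem measurableSet_Ioi] with r hr
    refine (Tendsto.liminf_eq ?_).symm
    exact ENNReal.tendsto_ofReal (((tendsto_mainardiApprox hα (le_of_lt hr)).comp
      (tendsto_add_atTop_nat 1)).const_mul _)
  have hint : Tendsto (fun m => ∫⁻ r in Set.Ioi (0 : ℝ), f m r) atTop
      (𝓝 (ENNReal.ofReal (k.factorial / Gamma (α * k + 1)))) := by
    have h := (((tendsto_rpow_mul_negBinom (α * k + 1)).const_mul (k.factorial : ℝ)).comp
      (tendsto_add_atTop_nat 1))
    rw [← div_eq_mul_inv] at h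
    refine (ENNReal.tendsto_ofReal h).congr fun m => ?_
    obtain ⟨hi, hv⟩ := moment_mainardiApprox α m.succ_pos k
    rw [← ofReal_integral_eq_lintegral_ofReal hi, hv]
    · rfl
    · filter_upwards [ae_restrict_mem measurableSet_Ioi] with r hr
      exact mul_nonneg (pow_nonneg (le_of_lt hr) _) (mainardiApprox_nonneg hα (le_of_lt hr) _)
  rw [lintegral_congr_ae hlim, ← hint.liminf_eq]
  exact lintegral_liminf_le' hf

lemma rpow_mul_exp_neg_le_Gamma {x L : ℝ} (hx : 0 ≤ x) (hL : 0 ≤ L) :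
    L ^ x * exp (-L) ≤ Gamma (x + 1) := by
  have hx1 : 0 < x + 1 := by linarith
  have hconv := GammaIntegral_convergent hx1
  have hsub : Set.Ioi L ⊆ Set.Ioi 0 := Set.Ioi_subset_Ioi hL
  rw [Gamma_eq_integral hx1]
  calc L ^ x * exp (-L) = ∫ u in Set.Ioi L, L ^ x * exp (-u) := by
        rw [integral_const_mul, integral_exp_neg_Ioi]
    _ ≤ ∫ u in Set.Ioi L, exp (-u) * u ^ (x + 1 - 1) := by
        refine setIntegral_mono_on ((integrableOn_exp_neg_Ioi L).const_mul _)
          (hconv.mono_set hsub) measurableSet_Ioi fun u hu => ?_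
        rw [add_sub_cancel_right, mul_comm]
        exact mul_le_mul_of_nonneg_left (rpow_le_rpow hL (le_of_lt hu) hx) (exp_pos _).le
    _ ≤ _ := by
        refine setIntegral_mono_set hconv ?_ hsub.eventuallyLE
        filter_upwards [ae_restrict_mem measurableSet_Ioi] with u hu
        exact mul_nonneg (exp_pos _).le (rpow_nonneg (le_of_lt hu) _)

lemma summable_mittagLeffler {α l : ℝ} (hα : 0 < α) (hl : 0 ≤ l) :
    Summable fun n : ℕ => l ^ n / Gamma (α * n + 1) := by
  set L : ℝ := (2 * (l + 1)) ^ α⁻¹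
  have hL : 0 < L := by positivity
  have hLα : L ^ α = 2 * (l + 1) := rpow_inv_rpow (by positivity) hα.ne'
  refine Summable.of_nonneg_of_le (fun n => ?_) (fun n => ?_)
    ((summable_geometric_of_lt_one (r := (1 / 2 : ℝ)) (by norm_num) (by norm_num)).mul_left
      (exp L))
  · exact div_nonneg (by positivity) (Gamma_pos_of_pos (by positivity)).le
  · have h := rpow_mul_exp_neg_le_Gamma (x := α * n) (by positivity) hL.le
    rw [rpow_mul hL.le, hLα, rpow_natCast] at h
    calc _ ≤ l ^ n / ((2 * (l + 1)) ^ n * exp (-L)) := by gcongr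
      _ = exp L * (l / (2 * (l + 1))) ^ n := by
        rw [exp_neg, div_pow]; field_simp
      _ ≤ _ := by
        gcongr exp L * ?_ ^ n
        rw [div_le_iff₀ (by positivity)]
        linarith

lemma lintegral_mainardi_mul_exp_le {α l : ℝ} (hα : α ∈ Set.Ioo (0 : ℝ) 1) (hl : 0 ≤ l) :
    ∫⁻ r in Set.Ioi (0 : ℝ), ENNReal.ofReal (mainardi α r * exp (l * r)) ≤
      ENNReal.ofReal (∑' n : ℕ, l ^ n / Gamma (α * n + 1)) := by
  have hexp : ∀ r ∈ Set.Ioi (0 : ℝ), ENNReal.ofReal (mainardi α r * exp (l * r)) =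
      ∑' n : ℕ, ENNReal.ofReal (l ^ n / n.factorial) * ENNReal.ofReal (r ^ n * mainardi α r) := by
    intro r hr
    have hr0 : 0 ≤ r := le_of_lt hr
    have hM := mainardi_nonneg hα hr0
    rw [Real.exp_eq_exp_ℝ, NormedSpace.exp_eq_tsum_div, ← tsum_mul_left,
      ENNReal.ofReal_tsum_of_nonneg (fun n => by positivity)
        ((Real.summable_pow_div_factorial (l * r)).mul_left _)]
    refine tsum_congr fun n => ?_
    rw [← ENNReal.ofReal_mul (by positivity), mul_pow]
    congr 1
    ring
  have hmeas : ∀ n : ℕ, AEMeasurable (fun r : ℝ => ENNReal.ofReal (r ^ n * mainardi α r))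
      (volume.restrict (Set.Ioi 0)) := fun n =>
    ((measurable_id.pow_const n).aemeasurable.mul (aemeasurable_mainardi hα)).ennreal_ofReal
  have hΓ : ∀ n : ℕ, 0 ≤ l ^ n / Gamma (α * n + 1) := fun n =>
    div_nonneg (by positivity) (Gamma_pos_of_pos (by have := hα.1; positivity)).le
  rw [setLIntegral_congr_fun measurableSet_Ioi hexp,
    lintegral_tsum fun n => (hmeas n).const_mul _,
    ENNReal.ofReal_tsum_of_nonneg hΓ (summable_mittagLeffler hα.1 hl)]
  refine ENNReal.tsum_le_tsum fun n => ?_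
  rw [lintegral_const_mul'' _ (hmeas n)]
  refine (mul_le_mul_right (lintegral_pow_mul_mainardi_le hα n) _).trans_eq ?_
  rw [← ENNReal.ofReal_mul (by positivity)]
  congr 1
  have : (n.factorial : ℝ) ≠ 0 := by positivity
  field_simp

theorem T_alpha_norm_bound
    {X : Type*} [NormedAddCommGroup X] [InnerProductSpace ℝ X] [CompleteSpace X]
    (T : ℝ → X →L[ℝ] X) (M ω α : ℝ) (hM : 1 ≤ M) (hω : 0 ≤ ω)
    (hα : α ∈ Set.Ioo (0 : ℝ) 1)
    (hT0 : T 0 = ContinuousLinearMap.id ℝ X)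
    (hTsemi : ∀ s t : ℝ, 0 ≤ s → 0 ≤ t → T (s + t) = (T s).comp (T t))
    (hTcont : ∀ x : X, ContinuousOn (fun t => T t x) (Set.Ici 0))
    (hTbound : ∀ t : ℝ, 0 ≤ t → ‖T t‖ ≤ M * Real.exp (ω * t)) :
    ∀ t : ℝ, 0 ≤ t →
      ‖∫ r in Set.Ioi (0 : ℝ), mainardi α r • T (t ^ α * r)‖ ≤
        M * ∑' n : ℕ, (ω * t ^ α) ^ n / Real.Gamma (α * n + 1) := by
  intro t ht
  have hM0 : 0 ≤ M := by linarith
  have hl : 0 ≤ ω * t ^ α := by positivity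
  have hE : 0 ≤ ∑' n : ℕ, (ω * t ^ α) ^ n / Real.Gamma (α * n + 1) := tsum_nonneg fun n =>
    div_nonneg (by positivity) (Gamma_pos_of_pos (by have := hα.1; positivity)).le
  rw [← ENNReal.ofReal_le_ofReal_iff (mul_nonneg hM0 hE), ofReal_norm]
  calc _ ≤ ∫⁻ r in Set.Ioi (0 : ℝ), ‖mainardi α r • T (t ^ α * r)‖ₑ :=
        enorm_integral_le_lintegral_enorm _
    _ ≤ ∫⁻ r in Set.Ioi (0 : ℝ),
          ENNReal.ofReal M * ENNReal.ofReal (mainardi α r * exp (ω * t ^ α * r)) := by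
        refine setLIntegral_mono' measurableSet_Ioi fun r hr => ?_
        have hr0 : 0 ≤ r := le_of_lt hr
        have hm := mainardi_nonneg hα hr0
        rw [← ofReal_norm, ← ENNReal.ofReal_mul hM0, norm_smul, Real.norm_of_nonneg hm]
        refine ENNReal.ofReal_le_ofReal ?_
        calc _ ≤ mainardi α r * (M * exp (ω * (t ^ α * r))) :=
              mul_le_mul_of_nonneg_left (hTbound _ (by positivity)) hm
          _ = _ := by rw [mul_assoc ω]; ring
    _ = ENNReal.ofReal M *
          ∫⁻ r in Set.Ioi (0 : ℝ), ENNReal.ofReal (mainardi α r * exp (ω * t ^ α * r)) :=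
        lintegral_const_mul' _ _ ENNReal.ofReal_ne_top
    _ ≤ _ := by
        rw [ENNReal.ofReal_mul hM0]
        gcongr
        exact lintegral_mainardi_mul_exp_le hα hl
end
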